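/- arXiv:2402.03075 — 4 statements merged into one kernel-verified Lean document; each statement's English description precedes it below -/
import Mathlib

section
/- Let 1 < q < ∞, n ≥ 1, and α < (q-1)n. The spherical Hardy operator 𝓗f(x) = (1/(ν_n|x|ⁿ)) ∫_{|y|<|x|} f(y) dy is bounded on the power-weighted space L^q(ℝⁿ, |x|^α dx) with operator norm exactly q/(q - 1 - α/n). -/
open MeasureTheory Set ENNReal Metric

/-- The power-weighted measure `|x|^α dx` on `ℝⁿ`. -/
noncomputable def powMeasure (n : ℕ) (α : ℝ) : Measure (EuclideanSpace ℝ (Fin n)) :=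
  volume.withDensity fun x => ENNReal.ofReal (‖x‖ ^ α)

/-- The `L^q` norm with respect to the weight `|x|^α`. -/
noncomputable def lqNormW (n : ℕ) (q α : ℝ) (f : EuclideanSpace ℝ (Fin n) → ℝ) : ℝ≥0∞ :=
  (∫⁻ x, ENNReal.ofReal |f x| ^ q ∂(powMeasure n α)) ^ (1 / q)

/-- The spherical Hardy operator `𝓗f(x) = (1/(ν_n|x|ⁿ)) ∫_{|y|≤|x|} f(y) dy`. -/
noncomputable def sphericalHardy (n : ℕ) (f : EuclideanSpace ℝ (Fin n) → ℝ)
    (x : EuclideanSpace ℝ (Fin n)) : ℝ :=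
  (volume (ball (0 : EuclideanSpace ℝ (Fin n)) ‖x‖)).toReal⁻¹ *
    ∫ y in closedBall (0 : EuclideanSpace ℝ (Fin n)) ‖x‖, f y


lemma polar_aux (n : ℕ) (hn : 1 ≤ n) (g : ℝ → ℝ)
    (hi : IntegrableOn (fun y : ℝ => y ^ (n-1) * g y) (Ioi 0)) :
    Integrable (fun x : EuclideanSpace ℝ (Fin n) => g ‖x‖) ∧
    ∫ x : EuclideanSpace ℝ (Fin n), g ‖x‖ =
      n * (volume (ball (0 : EuclideanSpace ℝ (Fin n)) 1)).toReal * 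
        ∫ y in Ioi (0:ℝ), y ^ (n-1) * g y := by
  have : NeZero n := ⟨by omega⟩
  have : Nontrivial (EuclideanSpace ℝ (Fin n)) := by infer_instance
  refine ⟨?_, ?_⟩
  · rw [integrable_fun_norm_addHaar]
    simpa using hi
  · rw [integral_fun_norm_addHaar]
    simp [Measure.real, mul_assoc]

lemma ball_aux (n : ℕ) (hn : 1 ≤ n) (D r : ℝ) (hD : 0 < D) (hr : 0 < r) :
    IntegrableOn (fun x : EuclideanSpace ℝ (Fin n) => ‖x‖ ^ (D - n)) (closedBall 0 r) ∧
    ∫ x in closedBall (0 : EuclideanSpace ℝ (Fin n)) r, ‖x‖ ^ (D - n) =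
      n * (volume (ball (0 : EuclideanSpace ℝ (Fin n)) 1)).toReal * (r ^ D / D) := by
  have key : EqOn (fun y : ℝ => y ^ (n-1) * (Iic r).indicator (fun t => t ^ (D - n)) y) 
     ((Iic r).indicator (fun t => t ^ (D - 1))) (Ioi 0) := by
    intro y hy
    simp only [indicator]
    split_ifs
    · rw [← Real.rpow_natCast, ← Real.rpow_add hy]
      congr 1
      push_cast [Nat.cast_sub hn]; ring
    · simp
  have hii : IntervalIntegrable (fun t : ℝ => t ^ (D - 1)) volume 0 r :=
    intervalIntegral.intervalIntegrable_rpow' (by linarith)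
  rw [intervalIntegrable_iff_integrableOn_Ioc_of_le hr.le] at hii
  have h := polar_aux n hn ((Iic r).indicator (fun t => t ^ (D - n)))
    (by
      rw [integrableOn_congr_fun key measurableSet_Ioi, IntegrableOn, integrable_indicator_iff measurableSet_Iic, IntegrableOn, Measure.restrict_restrict measurableSet_Iic, inter_comm, Ioi_inter_Iic]
      exact hii)
  have e : (fun x : EuclideanSpace ℝ (Fin n) => (Iic r).indicator (fun t => t ^ (D - n)) ‖x‖) = (closedBall 0 r).indicator (fun x => ‖x‖ ^ (D - n)) := by
    ext x; simp [indicator]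
  rw [e, integrable_indicator_iff measurableSet_closedBall, integral_indicator measurableSet_closedBall, setIntegral_congr_fun measurableSet_Ioi key, integral_indicator measurableSet_Iic, Measure.restrict_restrict measurableSet_Iic, inter_comm, Ioi_inter_Iic, ← intervalIntegral.integral_of_le hr.le, integral_rpow (Or.inl (by linarith))] at h
  simpa [hD.ne'] using h

lemma compl_aux (n : ℕ) (hn : 1 ≤ n) (D r : ℝ) (hD : 0 < D) (hr : 0 < r) :
    IntegrableOn (fun x : EuclideanSpace ℝ (Fin n) => ‖x‖ ^ (-n - D)) (ball 0 r)ᶜ ∧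
    ∫ x in (ball (0 : EuclideanSpace ℝ (Fin n)) r)ᶜ, ‖x‖ ^ (-n - D) =
      n * (volume (ball (0 : EuclideanSpace ℝ (Fin n)) 1)).toReal * (r ^ (-D) / D) := by
  have key : EqOn (fun y : ℝ => y ^ (n-1) * (Ici r).indicator (fun t => t ^ (-n - D)) y) 
     ((Ici r).indicator (fun t => t ^ (-D - 1))) (Ioi 0) := by
    intro y hy
    simp only [indicator]
    split_ifs
    · rw [← Real.rpow_natCast, ← Real.rpow_add hy]
      congr 1
      push_cast [Nat.cast_sub hn]; ring
    · simp
  have hs : Ici r ∩ Ioi 0 = Ici r := inter_eq_left.2 (fun x hx => hr.trans_le hx)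
  have h := polar_aux n hn ((Ici r).indicator (fun t => t ^ (-n - D)))
    (by
      rw [integrableOn_congr_fun key measurableSet_Ioi, IntegrableOn, integrable_indicator_iff measurableSet_Ici, IntegrableOn, Measure.restrict_restrict measurableSet_Ici, hs, ← IntegrableOn, integrableOn_Ici_iff_integrableOn_Ioi]
      exact integrableOn_Ioi_rpow_of_lt (by linarith) hr)
  have e : (fun x : EuclideanSpace ℝ (Fin n) => (Ici r).indicator (fun t => t ^ (-n - D)) ‖x‖) = (ball 0 r)ᶜ.indicator (fun x => ‖x‖ ^ (-n - D)) := by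
    ext x; simp [indicator]
  rw [e, integrable_indicator_iff measurableSet_ball.compl, integral_indicator measurableSet_ball.compl, setIntegral_congr_fun measurableSet_Ioi key, integral_indicator measurableSet_Ici, Measure.restrict_restrict measurableSet_Ici, hs, integral_Ici_eq_integral_Ioi, integral_Ioi_rpow_of_lt (by linarith) hr] at h
  simpa [hD.ne', neg_div_neg_eq] using h

lemma wint_aux (n : ℕ) (α : ℝ) (g : EuclideanSpace ℝ (Fin n) → ℝ≥0∞) :
    ∫⁻ x, g x ∂(powMeasure n α) = ∫⁻ x, ENNReal.ofReal (‖x‖ ^ α) * g x := by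
  unfold powMeasure
  rw [lintegral_withDensity_eq_lintegral_mul_non_measurable _ (by fun_prop) (by simp)]
  rfl

lemma ball_laux (n : ℕ) (hn : 1 ≤ n) (D r : ℝ) (hD : 0 < D) (hr : 0 < r) :
    ∫⁻ x in closedBall (0 : EuclideanSpace ℝ (Fin n)) r, ENNReal.ofReal (‖x‖ ^ (D - n)) =
      ENNReal.ofReal (n * (volume (ball (0 : EuclideanSpace ℝ (Fin n)) 1)).toReal * (r ^ D / D)) := by
  obtain ⟨h1, h2⟩ := ball_aux n hn D r hD hr
  rw [← h2, ofReal_integral_eq_lintegral_ofReal h1]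
  exact Filter.Eventually.of_forall fun x => Real.rpow_nonneg (norm_nonneg _) _

lemma compl_laux (n : ℕ) (hn : 1 ≤ n) (D r : ℝ) (hD : 0 < D) (hr : 0 < r) :
    ∫⁻ x in (ball (0 : EuclideanSpace ℝ (Fin n)) r)ᶜ, ENNReal.ofReal (‖x‖ ^ (-n - D)) =
      ENNReal.ofReal (n * (volume (ball (0 : EuclideanSpace ℝ (Fin n)) 1)).toReal *
        (r ^ (-D) / D)) := by
  obtain ⟨h1, h2⟩ := compl_aux n hn D r hD hr
  rw [← h2, ofReal_integral_eq_lintegral_ofReal h1]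
  exact Filter.Eventually.of_forall fun x => Real.rpow_nonneg (norm_nonneg _) _

lemma ae_ne_aux (n : ℕ) (hn : 1 ≤ n) : ∀ᵐ x : EuclideanSpace ℝ (Fin n), 0 < ‖x‖ := by
  have : NeZero n := ⟨by omega⟩
  have : Nontrivial (EuclideanSpace ℝ (Fin n)) := by infer_instance
  filter_upwards [Measure.ae_ne volume (0 : EuclideanSpace ℝ (Fin n))] with x hx
  exact norm_pos_iff.2 hx

lemma vol_pos_aux (n : ℕ) : 0 < (volume (ball (0 : EuclideanSpace ℝ (Fin n)) 1)).toReal :=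
  ENNReal.toReal_pos (measure_ball_pos _ _ one_pos).ne' measure_ball_lt_top.ne

lemma vol_ball_aux (n : ℕ) (r : ℝ) (hr : 0 < r) :
    (volume (ball (0 : EuclideanSpace ℝ (Fin n)) r)).toReal =
      r ^ (n : ℝ) * (volume (ball (0 : EuclideanSpace ℝ (Fin n)) 1)).toReal := by
  rw [Measure.addHaar_ball_of_pos _ _ hr, ENNReal.toReal_mul, ENNReal.toReal_ofReal (by positivity)]
  simp

lemma holder_aux (n : ℕ) (hn : 1 ≤ n) (q D r : ℝ) (hq : 1 < q) (hD : 0 < D) (hr : 0 < r)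
    (F : EuclideanSpace ℝ (Fin n) → ℝ≥0∞) (hF : Measurable F) :
    (∫⁻ y in closedBall (0 : EuclideanSpace ℝ (Fin n)) r, F y) ^ q ≤
      ENNReal.ofReal ((n * (volume (ball (0 : EuclideanSpace ℝ (Fin n)) 1)).toReal *
        (r ^ D / D)) ^ (q - 1)) *
      ∫⁻ y in closedBall (0 : EuclideanSpace ℝ (Fin n)) r,
        F y ^ q * ENNReal.ofReal (‖y‖ ^ ((n - D) * (q - 1))) := by
  have hq0 : 0 < q := by linarith
  have hq1 : 0 < q - 1 := by linarith
  have hpq : q.HolderConjugate (q / (q - 1)) := Real.HolderConjugate.conjExponent hq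
  set s := (n - D) * (q - 1) / q with hs
  have hV := vol_pos_aux n
  have H := lintegral_mul_le_Lp_mul_Lq
    (volume.restrict (closedBall (0 : EuclideanSpace ℝ (Fin n)) r)) hpq
    (f := fun y => F y * ENNReal.ofReal (‖y‖ ^ s)) (g := fun y => ENNReal.ofReal (‖y‖ ^ (-s)))
    (by fun_prop) (by fun_prop)
  have e1 : ∫⁻ y in closedBall (0 : EuclideanSpace ℝ (Fin n)) r,
      ((fun y => F y * ENNReal.ofReal (‖y‖ ^ s) : EuclideanSpace ℝ (Fin n) → ℝ≥0∞) *
        (fun y => ENNReal.ofReal (‖y‖ ^ (-s)) : EuclideanSpace ℝ (Fin n) → ℝ≥0∞)) y =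
      ∫⁻ y in closedBall (0 : EuclideanSpace ℝ (Fin n)) r, F y := by
    apply lintegral_congr_ae
    filter_upwards [ae_restrict_of_ae (ae_ne_aux n hn)] with y hy
    simp only [Pi.mul_apply]
    rw [mul_assoc, ← ENNReal.ofReal_mul (by positivity), ← Real.rpow_add hy]
    simp
  have e2 : ∀ y : EuclideanSpace ℝ (Fin n), (F y * ENNReal.ofReal (‖y‖ ^ s)) ^ q =
      F y ^ q * ENNReal.ofReal (‖y‖ ^ ((n - D) * (q - 1))) := by
    intro y
    rw [ENNReal.mul_rpow_of_nonneg _ _ hq0.le, ENNReal.ofReal_rpow_of_nonneg (by positivity) hq0.le,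
      ← Real.rpow_mul (norm_nonneg _), hs, div_mul_cancel₀ _ hq0.ne']
  have e3 : ∀ y : EuclideanSpace ℝ (Fin n), ENNReal.ofReal (‖y‖ ^ (-s)) ^ (q / (q - 1)) =
      ENNReal.ofReal (‖y‖ ^ (D - n)) := by
    intro y
    rw [ENNReal.ofReal_rpow_of_nonneg (by positivity) (by positivity),
      ← Real.rpow_mul (norm_nonneg _), hs]
    congr 2
    field_simp
    ring
  rw [e1] at H
  simp only [e2, e3] at H
  rw [ball_laux n hn D r hD hr] at H
  have H2 := ENNReal.rpow_le_rpow H hq0.le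
  rw [ENNReal.mul_rpow_of_nonneg _ _ hq0.le, ← ENNReal.rpow_mul, ← ENNReal.rpow_mul,
    one_div_mul_cancel hq0.ne', ENNReal.rpow_one, mul_comm] at H2
  rw [← ENNReal.ofReal_rpow_of_nonneg (by positivity) hq1.le]
  convert H2 using 3
  field_simp

lemma const_aux (n : ℕ) (hn : 1 ≤ n) (q α D r V : ℝ) (hD : 0 < D) (hr : 0 < r)
    (hV : 0 < V) (hα : α = n * (q - 1) - D * q) :
    r ^ α * ((r ^ (n : ℝ) * V)⁻¹ ^ q * (n * V * (r ^ D / D)) ^ (q - 1)) =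
      V⁻¹ * (n / D) ^ (q - 1) * r ^ (-n - D) := by
  have hn' : (0 : ℝ) < n := by exact_mod_cast hn
  apply Real.log_injOn_pos (by simp only [mem_Ioi]; positivity) (by simp only [mem_Ioi]; positivity)
  have h1 : r ^ (n : ℝ) ≠ 0 := by positivity
  have h2 : r ^ D ≠ 0 := by positivity
  rw [Real.log_mul (by positivity) (by positivity), Real.log_mul (by positivity) (by positivity),
    Real.log_mul (by positivity) (by positivity), Real.log_mul (by positivity) (by positivity),
    Real.log_rpow hr, Real.log_rpow (by positivity), Real.log_rpow (by positivity),
    Real.log_rpow (by positivity), Real.log_rpow hr, Real.log_inv, Real.log_inv,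
    Real.log_mul (by positivity) (by positivity), Real.log_mul (by positivity) (by positivity),
    Real.log_mul (by positivity) (by positivity), Real.log_div (by positivity) (by positivity),
    Real.log_div (by positivity) (by positivity), Real.log_rpow hr, Real.log_rpow hr, hα]
  ring

lemma point_aux (n : ℕ) (hn : 1 ≤ n) (q α D : ℝ) (hq : 1 < q) (hD : 0 < D)
    (hα : α = n * (q - 1) - D * q)
    (f : EuclideanSpace ℝ (Fin n) → ℝ) (hf : Measurable f) (x : EuclideanSpace ℝ (Fin n))
    (hx : 0 < ‖x‖) :
    ENNReal.ofReal (‖x‖ ^ α) * ENNReal.ofReal |sphericalHardy n f x| ^ q ≤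
      ENNReal.ofReal ((volume (ball (0 : EuclideanSpace ℝ (Fin n)) 1)).toReal⁻¹ *
        (n / D) ^ (q - 1) * ‖x‖ ^ (-n - D)) *
      ∫⁻ y in closedBall (0 : EuclideanSpace ℝ (Fin n)) ‖x‖,
        ENNReal.ofReal |f y| ^ q * ENNReal.ofReal (‖y‖ ^ ((n - D) * (q - 1))) := by
  have hq0 : 0 < q := by linarith
  have hV := vol_pos_aux n
  rw [← const_aux n hn q α D ‖x‖ _ hD hx hV hα]
  rw [ENNReal.ofReal_mul (by positivity), ENNReal.ofReal_mul (by positivity), mul_assoc, mul_assoc]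
  gcongr
  have h1 : ENNReal.ofReal |sphericalHardy n f x| ≤
      ENNReal.ofReal (‖x‖ ^ (n : ℝ) * (volume (ball (0 : EuclideanSpace ℝ (Fin n)) 1)).toReal)⁻¹ *
      ∫⁻ y in closedBall (0 : EuclideanSpace ℝ (Fin n)) ‖x‖, ENNReal.ofReal |f y| := by
    unfold sphericalHardy
    rw [vol_ball_aux n _ hx, abs_mul, abs_of_nonneg (by positivity), ENNReal.ofReal_mul (by positivity)]
    gcongr
    have := enorm_integral_le_lintegral_enorm
      (μ := volume.restrict (closedBall (0 : EuclideanSpace ℝ (Fin n)) ‖x‖)) f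
    simpa only [Real.enorm_eq_ofReal_abs] using this
  refine (ENNReal.rpow_le_rpow h1 hq0.le).trans ?_
  rw [ENNReal.mul_rpow_of_nonneg _ _ hq0.le, ENNReal.ofReal_rpow_of_nonneg (by positivity) hq0.le]
  gcongr
  exact holder_aux n hn q D _ hq hD hx _ (by fun_prop)

lemma upper_aux (n : ℕ) (hn : 1 ≤ n) (q α D : ℝ) (hq : 1 < q) (hD : 0 < D)
    (hα : α = n * (q - 1) - D * q)
    (f : EuclideanSpace ℝ (Fin n) → ℝ) (hf : Measurable f) :
    lqNormW n q α (sphericalHardy n f) ≤ ENNReal.ofReal (n / D) * lqNormW n q α f := by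
  have hq0 : 0 < q := by linarith
  have hV := vol_pos_aux n
  set V := (volume (ball (0 : EuclideanSpace ℝ (Fin n)) 1)).toReal with hVdef
  have hn' : (0 : ℝ) < n := by exact_mod_cast hn
  unfold lqNormW
  have hC : ENNReal.ofReal (n / D) = (ENNReal.ofReal ((n / D) ^ q)) ^ (1 / q) := by
    rw [ENNReal.ofReal_rpow_of_nonneg (by positivity) (by positivity), ← Real.rpow_mul (by positivity),
      mul_one_div_cancel hq0.ne', Real.rpow_one]
  rw [hC, ← ENNReal.mul_rpow_of_nonneg _ _ (by positivity)]
  gcongr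
  rw [wint_aux, wint_aux]
  set K : EuclideanSpace ℝ (Fin n) → ℝ≥0∞ := fun x =>
    ENNReal.ofReal (V⁻¹ * (n / D) ^ (q - 1) * ‖x‖ ^ (-n - D)) with hK
  set G : EuclideanSpace ℝ (Fin n) → ℝ≥0∞ := fun y =>
    ENNReal.ofReal |f y| ^ q * ENNReal.ofReal (‖y‖ ^ ((n - D) * (q - 1))) with hG
  have hKm : Measurable K := by fun_prop
  have hGm : Measurable G := by fun_prop
  let S : Set (EuclideanSpace ℝ (Fin n) × EuclideanSpace ℝ (Fin n)) := {p | ‖p.2‖ ≤ ‖p.1‖}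
  have hS : MeasurableSet S := measurableSet_le (by fun_prop) (by fun_prop)
  let T : EuclideanSpace ℝ (Fin n) → EuclideanSpace ℝ (Fin n) → ℝ≥0∞ := fun x y =>
    S.indicator (fun p => K p.1 * G p.2) (x, y)
  have hT : Measurable (Function.uncurry T) := by
    change Measurable (S.indicator (fun p => K p.1 * G p.2))
    exact Measurable.indicator (by fun_prop) hS
  calc ∫⁻ x, ENNReal.ofReal (‖x‖ ^ α) * ENNReal.ofReal |sphericalHardy n f x| ^ q
      ≤ ∫⁻ x, ∫⁻ y, T x y := by
        apply lintegral_mono_ae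
        filter_upwards [ae_ne_aux n hn] with x hx
        refine (point_aux n hn q α D hq hD hα f hf x hx).trans_eq ?_
        rw [← lintegral_const_mul _ hGm, ← lintegral_indicator measurableSet_closedBall]
        apply lintegral_congr
        intro y
        simp [T, S, indicator, hK, hG, hVdef]
    _ = ∫⁻ y, ∫⁻ x, T x y := lintegral_lintegral_swap hT.aemeasurable
    _ = ∫⁻ y, ENNReal.ofReal ((n / D) ^ q) * (ENNReal.ofReal (‖y‖ ^ α) * ENNReal.ofReal |f y| ^ q) := by
        apply lintegral_congr_ae
        filter_upwards [ae_ne_aux n hn] with y hy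
        have : ∀ x, T x y = (ball (0 : EuclideanSpace ℝ (Fin n)) ‖y‖)ᶜ.indicator
            (fun x => (ENNReal.ofReal (V⁻¹ * (n / D) ^ (q - 1)) * G y) *
              ENNReal.ofReal (‖x‖ ^ (-n - D))) x := by
          intro x
          simp only [T, S, indicator, hK, mem_compl_iff, mem_ball_zero_iff, not_lt, mem_ofPred_eq]
          split_ifs
          · rw [ENNReal.ofReal_mul (by positivity)]; ring
          · rfl
        simp_rw [this]
        rw [lintegral_indicator measurableSet_ball.compl, lintegral_const_mul _ (by fun_prop),
          compl_laux n hn D _ hD hy]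
        simp only [hG]
        rw [← hVdef]
        have e : (n / D) ^ q * ‖y‖ ^ α = V⁻¹ * (n / D) ^ (q - 1) * ‖y‖ ^ ((n - D) * (q - 1)) *
            (n * V * (‖y‖ ^ (-D) / D)) := by
          have e1 : ‖y‖ ^ α = ‖y‖ ^ ((n - D) * (q - 1)) * ‖y‖ ^ (-D) := by
            rw [← Real.rpow_add hy, hα]; congr 1; ring
          rw [e1, Real.rpow_sub_one (by positivity)]
          field_simp
        rw [← mul_assoc (ENNReal.ofReal ((n / D) ^ q)), ← ENNReal.ofReal_mul (by positivity), e,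
          ENNReal.ofReal_mul (p := V⁻¹ * (n / D) ^ (q - 1) * ‖y‖ ^ ((n - D) * (q - 1)))
            (by positivity),
          ENNReal.ofReal_mul (p := V⁻¹ * (n / D) ^ (q - 1)) (by positivity)]
        ring
    _ = _ := by rw [lintegral_const_mul _ (by fun_prop)]

lemma lower_aux (n : ℕ) (hn : 1 ≤ n) (q α E : ℝ) (hq : 1 < q) (hE : 0 < E)
    (hα : 0 < n + α - (n - E) * q) (C : ℝ≥0∞)
    (hC : ∀ f : EuclideanSpace ℝ (Fin n) → ℝ, Measurable f → lqNormW n q α f < ⊤ →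
        lqNormW n q α (sphericalHardy n f) ≤ C * lqNormW n q α f) :
    ENNReal.ofReal (n / E) ≤ C := by
  have hq0 : 0 < q := by linarith
  have hV := vol_pos_aux n
  have hn' : (0 : ℝ) < n := by exact_mod_cast hn
  set f : EuclideanSpace ℝ (Fin n) → ℝ :=
    (closedBall 0 1).indicator (fun x => ‖x‖ ^ (E - n)) with hf
  have hfm : Measurable f := Measurable.indicator (by fun_prop) measurableSet_closedBall
  have hI : ∫⁻ x, ENNReal.ofReal |f x| ^ q ∂(powMeasure n α) =
      ENNReal.ofReal (n * (volume (ball (0 : EuclideanSpace ℝ (Fin n)) 1)).toReal *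
        (1 / (n + α - (n - E) * q))) := by
    have := ball_laux n hn _ 1 hα one_pos
    rw [Real.one_rpow] at this
    rw [wint_aux, ← this, ← lintegral_indicator measurableSet_closedBall]
    apply lintegral_congr_ae
    filter_upwards [ae_ne_aux n hn] with x hx
    simp only [hf, indicator]
    split_ifs
    · rw [abs_of_nonneg (by positivity), ENNReal.ofReal_rpow_of_nonneg (by positivity) hq0.le,
        ← ENNReal.ofReal_mul (by positivity), ← Real.rpow_mul hx.le, ← Real.rpow_add hx]
      congr 2; ring
    · simp [hq0]
  have hpos : lqNormW n q α f ≠ 0 := by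
    unfold lqNormW
    rw [hI, ENNReal.ofReal_rpow_of_pos (by positivity)]
    simp only [ne_eq, ENNReal.ofReal_eq_zero, not_le]
    positivity
  have hfin : lqNormW n q α f < ⊤ := by
    unfold lqNormW
    rw [hI, ENNReal.ofReal_rpow_of_pos (by positivity)]
    exact ENNReal.ofReal_lt_top
  have hH : ∀ x : EuclideanSpace ℝ (Fin n), 0 < ‖x‖ → ‖x‖ ≤ 1 →
      sphericalHardy n f x = n / E * ‖x‖ ^ (E - n) := by
    intro x hx hx1
    unfold sphericalHardy
    have : ∫ y in closedBall (0 : EuclideanSpace ℝ (Fin n)) ‖x‖, f y =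
        ∫ y in closedBall (0 : EuclideanSpace ℝ (Fin n)) ‖x‖, ‖y‖ ^ (E - n) := by
      apply setIntegral_congr_fun measurableSet_closedBall
      intro y hy
      simp only [hf]
      rw [indicator_of_mem]
      exact closedBall_subset_closedBall hx1 hy
    rw [this, (ball_aux n hn E _ hE hx).2, vol_ball_aux n _ hx, Real.rpow_sub hx]
    field_simp
  have hle : ENNReal.ofReal (n / E) * lqNormW n q α f ≤ lqNormW n q α (sphericalHardy n f) := by
    unfold lqNormW
    have hC : ENNReal.ofReal (n / E) = (ENNReal.ofReal ((n / E) ^ q)) ^ (1 / q) := by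
      rw [ENNReal.ofReal_rpow_of_nonneg (by positivity) (by positivity),
        ← Real.rpow_mul (by positivity), mul_one_div_cancel hq0.ne', Real.rpow_one]
    rw [hC, ← ENNReal.mul_rpow_of_nonneg _ _ (by positivity)]
    gcongr
    rw [wint_aux, wint_aux, ← lintegral_const_mul _ (by fun_prop)]
    apply lintegral_mono_ae
    filter_upwards [ae_ne_aux n hn] with x hx
    by_cases hx1 : ‖x‖ ≤ 1
    · rw [hH x hx hx1]
      simp only [hf]
      rw [indicator_of_mem (by simpa using hx1), abs_of_nonneg (by positivity),
        abs_of_nonneg (by positivity), ENNReal.ofReal_rpow_of_nonneg (by positivity) hq0.le,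
        ENNReal.ofReal_rpow_of_nonneg (by positivity) hq0.le, Real.mul_rpow (by positivity)
        (by positivity), ENNReal.ofReal_mul (p := (n / E) ^ q) (by positivity)]
      exact le_of_eq (by ring)
    · simp only [hf]
      rw [indicator_of_notMem (by simpa using hx1)]
      simp [hq0]
  have h := hle.trans (hC f hfm hfin)
  exact (ENNReal.mul_le_mul_iff_left hpos hfin.ne).1 h

/-- The spherical Hardy operator is bounded on `L^q(ℝⁿ, |x|^α dx)` for `1 < q < ∞`,
`α < (q-1)n`, with operator norm exactly `q/(q - 1 - α/n)`. -/
theorem sphericalHardy_weighted_norm (n : ℕ) (hn : 1 ≤ n) (q α : ℝ) (hq : 1 < q)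
    (hα : α < (q - 1) * n) :
    (∀ f : EuclideanSpace ℝ (Fin n) → ℝ, Measurable f → lqNormW n q α f < ⊤ →
      lqNormW n q α (sphericalHardy n f)
        ≤ ENNReal.ofReal (q / (q - 1 - α / n)) * lqNormW n q α f) ∧
    (∀ C : ℝ≥0∞,
      (∀ f : EuclideanSpace ℝ (Fin n) → ℝ, Measurable f → lqNormW n q α f < ⊤ →
        lqNormW n q α (sphericalHardy n f) ≤ C * lqNormW n q α f) →
      ENNReal.ofReal (q / (q - 1 - α / n)) ≤ C) := by
  have hn' : (0 : ℝ) < n := by exact_mod_cast hn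
  have hq0 : 0 < q := by linarith
  set D : ℝ := ((q - 1) * n - α) / q with hDdef
  have hD : 0 < D := div_pos (by linarith) hq0
  have hα' : α = n * (q - 1) - D * q := by
    rw [hDdef, div_mul_cancel₀ _ hq0.ne']; ring
  have hc : q / (q - 1 - α / n) = n / D := by
    have : (q - 1) * n - α ≠ 0 := by linarith
    have h2 : q - 1 - α / n = ((q - 1) * n - α) / n := by field_simp
    rw [h2, hDdef]
    field_simp
  rw [hc]
  refine ⟨fun f hf _ => upper_aux n hn q α D hq hD hα' f hf, fun C hC => ?_⟩
  have hlim : Filter.Tendsto (fun E : ℝ => ENNReal.ofReal (n / E)) (nhdsWithin D (Ioi D))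
      (nhds (ENNReal.ofReal (n / D))) := by
    apply ENNReal.tendsto_ofReal
    apply Filter.Tendsto.mono_left _ nhdsWithin_le_nhds
    exact tendsto_const_nhds.div Filter.tendsto_id hD.ne'
  refine le_of_tendsto hlim ?_
  filter_upwards [self_mem_nhdsWithin] with E hE
  have hE' : D < E := hE
  refine lower_aux n hn q α E hq (hD.trans hE') ?_ C hC
  have : 0 < (E - D) * q := mul_pos (by linarith) hq0
  rw [hα']; linarith
end

section
/- Let 1 < q < ∞ and -1/q ≤ λ ≤ 0. The spherical Hardy operator 𝓗 satisfies ‖𝓗f‖_{𝓑^{q,λ}(ℝⁿ)} ≤ (1/(1+λ)) ‖f‖_{𝓑^{q,λ}(ℝⁿ)} for all f in the λ-central Morrey space, and the operator norm of 𝓗 on 𝓑^{q,λ}(ℝⁿ) equals 1/(1+λ). -/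
open MeasureTheory Set ENNReal Metric

/-- The `λ`-central Morrey norm
`‖f‖_{𝓑^{q,λ}} = sup_{r>0} (|B(0,r)|^{-(1+λq)} ∫_{B(0,r)} |f|^q)^{1/q}`. -/
noncomputable def centralMorreyNorm (n : ℕ) (q lam : ℝ)
    (f : EuclideanSpace ℝ (Fin n) → ℝ) : ℝ≥0∞ :=
  ⨆ (r : ℝ) (_ : 0 < r),
    ((volume (ball (0 : EuclideanSpace ℝ (Fin n)) r)) ^ (1 + lam * q))⁻¹ ^ (1 / q) *
      (∫⁻ x in ball (0 : EuclideanSpace ℝ (Fin n)) r, ENNReal.ofReal |f x| ^ q) ^ (1 / q)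

/-- Volume of the centred ball through `x`. -/
noncomputable def hV (n : ℕ) (x : EuclideanSpace ℝ (Fin n)) : ℝ :=
  (volume (ball (0 : EuclideanSpace ℝ (Fin n)) ‖x‖)).toReal

/-- Volume of the unit ball. -/
noncomputable def hnu (n : ℕ) : ℝ := (volume (ball (0 : EuclideanSpace ℝ (Fin n)) 1)).toReal

lemma hnu_pos (n : ℕ) : 0 < hnu n :=
  ENNReal.toReal_pos (measure_ball_pos _ _ one_pos).ne' measure_ball_lt_top.ne

lemma vol_ball (n : ℕ) (hn : 1 ≤ n) (r : ℝ) (hr : 0 ≤ r) :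
    volume (ball (0 : EuclideanSpace ℝ (Fin n)) r) = ENNReal.ofReal (hnu n * r ^ n) := by
  have : Nonempty (Fin n) := ⟨⟨0, hn⟩⟩
  rw [Measure.addHaar_ball _ _ hr, hnu, mul_comm (ENNReal.toReal _),
    ENNReal.ofReal_mul (by positivity), ENNReal.ofReal_toReal measure_ball_lt_top.ne]
  simp

lemma hV_eq (n : ℕ) (hn : 1 ≤ n) (x : EuclideanSpace ℝ (Fin n)) : hV n x = hnu n * ‖x‖ ^ n := by
  rw [hV, vol_ball n hn _ (norm_nonneg x), ENNReal.toReal_ofReal]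
  have := hnu_pos n
  positivity

lemma hV_nonneg (n : ℕ) (x : EuclideanSpace ℝ (Fin n)) : 0 ≤ hV n x := ENNReal.toReal_nonneg

lemma hV_meas (n : ℕ) (hn : 1 ≤ n) : Measurable (hV n) := by
  have : hV n = fun x => hnu n * ‖x‖ ^ n := funext (hV_eq n hn)
  rw [this]; fun_prop

lemma hV_lt_iff (n : ℕ) (hn : 1 ≤ n) (x : EuclideanSpace ℝ (Fin n)) (r : ℝ) (hr : 0 ≤ r) :
    hV n x < hnu n * r ^ n ↔ ‖x‖ < r := by
  rw [hV_eq n hn, mul_lt_mul_iff_right₀ (hnu_pos n)]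
  exact pow_lt_pow_iff_left₀ (norm_nonneg x) hr (by omega)

lemma ball_eq_hV (n : ℕ) (hn : 1 ≤ n) (r : ℝ) (hr : 0 ≤ r) :
    ball (0 : EuclideanSpace ℝ (Fin n)) r = {x | hV n x < hnu n * r ^ n} := by
  ext x
  rw [mem_ofPred_eq, hV_lt_iff n hn x r hr]; simp

lemma exists_radius (n : ℕ) (hn : 1 ≤ n) (R : ℝ) (hR : 0 ≤ R) :
    ∃ r : ℝ, 0 ≤ r ∧ hnu n * r ^ n = R := by
  have := hnu_pos n
  refine ⟨(R / hnu n) ^ (1 / (n : ℝ)), by positivity, ?_⟩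
  rw [← Real.rpow_natCast, ← Real.rpow_mul (by positivity)]
  have : (n : ℝ) ≠ 0 := by positivity
  rw [one_div_mul_cancel this, Real.rpow_one]
  field_simp

lemma vol_hV_lt (n : ℕ) (hn : 1 ≤ n) (R : ℝ) :
    volume {x | hV n x < R} = ENNReal.ofReal R := by
  rcases le_total 0 R with hR | hR
  · obtain ⟨r, hr, rfl⟩ := exists_radius n hn R hR
    rw [← ball_eq_hV n hn r hr, vol_ball n hn r hr]
  · rw [ENNReal.ofReal_of_nonpos hR]
    convert measure_empty (μ := (volume : Measure (EuclideanSpace ℝ (Fin n))))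
    ext x
    simpa using hR.trans (hV_nonneg n x)

lemma hV_map (n : ℕ) (hn : 1 ≤ n) :
    Measure.map (hV n) volume = (volume : Measure ℝ).restrict (Ioi 0) := by
  have hm := hV_meas n hn
  have key : ∀ a b : ℝ, Measure.map (hV n) volume (Ico a b)
      = (volume : Measure ℝ).restrict (Ioi 0) (Ico a b) := by
    intro a b
    rw [Measure.map_apply hm measurableSet_Ico, Measure.restrict_apply measurableSet_Ico]
    have h1 : hV n ⁻¹' Ico a b = {x | hV n x < b} \ {x | hV n x < a} := by
      ext x; simp [and_comm]
    rcases le_total b a with h | h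
    · simp [Ico_eq_empty_of_le h]
    have hsub : {x | hV n x < a} ⊆ {x | hV n x < b} := fun x hx => lt_of_lt_of_le hx h
    have hfin : volume {x | hV n x < a} ≠ ⊤ := by rw [vol_hV_lt n hn]; simp
    rw [h1, measure_sdiff hsub
      (measurableSet_lt hm measurable_const).nullMeasurableSet hfin,
      vol_hV_lt n hn, vol_hV_lt n hn]
    rcases lt_or_ge 0 a with ha | ha
    · have h2 : Ico a b ⊆ Ioi 0 := fun x hx => lt_of_lt_of_le ha hx.1
      rw [inter_eq_left.2 h2, Real.volume_Ico,
        ENNReal.ofReal_sub _ ha.le]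
    · have h2 : Ico a b ∩ Ioi 0 = Ioo 0 b := by
        ext x; simp only [mem_inter_iff, mem_Ico, mem_Ioi, mem_Ioo]
        constructor
        · rintro ⟨⟨_, h⟩, h'⟩; exact ⟨h', h⟩
        · rintro ⟨h', h⟩; exact ⟨⟨by linarith, h⟩, h'⟩
      rw [h2, Real.volume_Ioo, ENNReal.ofReal_of_nonpos ha]; simp
  refine (Measure.ext_of_Ico' _ _ ?_ ?_)
  · intro a b _
    rw [key]
    exact ((Measure.restrict_apply_le _ _).trans_lt (by simp)).ne
  · intro a b _; exact key a b

lemma hV_ae_pos (n : ℕ) (hn : 1 ≤ n) : ∀ᵐ x, 0 < hV n x := by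
  have h : ∀ᵐ v ∂(Measure.map (hV n) volume), 0 < v := by
    rw [hV_map n hn]; exact ae_restrict_mem measurableSet_Ioi
  exact ae_of_ae_map (hV_meas n hn).aemeasurable h

/-- Radial integration. -/
lemma lint_hV (n : ℕ) (hn : 1 ≤ n) (g : ℝ → ℝ≥0∞) (hg : Measurable g) (S : Set ℝ)
    (hS : MeasurableSet S) (hS0 : S ⊆ Ioi 0) :
    ∫⁻ x in {x | hV n x ∈ S}, g (hV n x) = ∫⁻ v in S, g v := by
  have hm := hV_meas n hn
  have h := setLIntegral_map (μ := (volume : Measure (EuclideanSpace ℝ (Fin n)))) hS hg hm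
  rw [hV_map n hn, Measure.restrict_restrict hS, inter_eq_left.2 hS0] at h
  exact h.symm

lemma lint_pow (b R p : ℝ) (hb : 0 ≤ b) (hbR : b ≤ R) (hp : 0 < b ∨ -1 < p) :
    ∫⁻ v in Ioo b R, ENNReal.ofReal v ^ p = ENNReal.ofReal (∫ v in b..R, v ^ p) := by
  have hi : IntervalIntegrable (fun v : ℝ => v ^ p) volume b R := by
    rcases hp with h | h
    · apply intervalIntegral.intervalIntegrable_rpow
      right; rw [uIcc_of_le hbR]; intro h'; exact absurd h'.1 (not_le.2 h)
    · exact intervalIntegral.intervalIntegrable_rpow' h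
  rw [intervalIntegral.integral_of_le hbR, integral_Ioc_eq_integral_Ioo,
    ofReal_integral_eq_lintegral_ofReal]
  · refine setLIntegral_congr_fun measurableSet_Ioo fun v hv => ?_
    exact ENNReal.ofReal_rpow_of_pos (hb.trans_lt hv.1)
  · exact ((intervalIntegrable_iff_integrableOn_Ioo_of_le hbR).1 hi)
  · refine (ae_restrict_mem measurableSet_Ioo).mono fun v hv => ?_
    exact Real.rpow_nonneg (hb.trans hv.1.le) _

lemma lint_V_pow (n : ℕ) (hn : 1 ≤ n) (R p : ℝ) (hR : 0 ≤ R) (hp : -1 < p) :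
    ∫⁻ x in {x | hV n x < R}, ENNReal.ofReal (hV n x) ^ p
      = ENNReal.ofReal (R ^ (p + 1) / (p + 1)) := by
  have h1 : ∫⁻ x in {x | hV n x < R}, ENNReal.ofReal (hV n x) ^ p
      = ∫⁻ x in {x | hV n x ∈ Ioo 0 R}, ENNReal.ofReal (hV n x) ^ p := by
    refine setLIntegral_congr ?_
    filter_upwards [hV_ae_pos n hn] with x hx
    apply propext
    exact ⟨fun h => ⟨hx, h⟩, fun h => h.2⟩
  rw [h1, lint_hV n hn (fun v => ENNReal.ofReal v ^ p) (by fun_prop) _ measurableSet_Ioo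
    (fun x hx => hx.1), lint_pow 0 R p le_rfl hR (Or.inr hp), integral_rpow (Or.inl hp),
    Real.zero_rpow (by linarith)]
  simp

lemma pow_ident (b R s : ℝ) (hb : 0 < b) (hbR : b ≤ R) (hs : 0 ≤ s) :
    b ^ s * ∫ v in b..R, v ^ (-1 - s) = R ^ (-s) * ∫ v in b..R, v ^ (s - 1) := by
  have hR : 0 < R := hb.trans_le hbR
  rcases hs.eq_or_lt with rfl | hs
  · simp
  have h0 : (0 : ℝ) ∉ uIcc b R := by
    rw [uIcc_of_le hbR]; intro h'; exact absurd h'.1 (not_le.2 hb)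
  rw [integral_rpow (Or.inr ⟨by linarith, h0⟩), integral_rpow (Or.inl (by linarith))]
  have e1 : -1 - s + 1 = -s := by ring
  have e2 : s - 1 + 1 = s := by ring
  rw [e1, e2, Real.rpow_neg hR.le, Real.rpow_neg hb.le]
  have := Real.rpow_pos_of_pos hb s
  have := Real.rpow_pos_of_pos hR s
  field_simp
  ring

lemma pow_ident' (n : ℕ) (hn : 1 ≤ n) (b R s : ℝ) (hb : 0 < b) (hbR : b ≤ R) (hs : 0 ≤ s) :
    ENNReal.ofReal b ^ s *
      ∫⁻ x in {x | hV n x ∈ Ioo b R}, ENNReal.ofReal (hV n x) ^ (-1 - s)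
    = ENNReal.ofReal (R ^ (-s)) *
      ∫⁻ x in {x | hV n x ∈ Ioo b R}, ENNReal.ofReal (hV n x) ^ (s - 1) := by
  have hR : 0 < R := hb.trans_le hbR
  rw [lint_hV n hn (fun v => ENNReal.ofReal v ^ (-1 - s)) (by fun_prop) _ measurableSet_Ioo
    (fun x hx => hb.trans hx.1), lint_hV n hn (fun v => ENNReal.ofReal v ^ (s - 1)) (by fun_prop) _
    measurableSet_Ioo (fun x hx => hb.trans hx.1), lint_pow b R _ hb.le hbR (Or.inl hb),
    lint_pow b R _ hb.le hbR (Or.inl hb), ENNReal.ofReal_rpow_of_pos hb,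
    ← ENNReal.ofReal_mul (by positivity), ← ENNReal.ofReal_mul (by positivity),
    pow_ident b R s hb hbR hs]

/-- Tonelli on the triangle. -/
lemma tonelli (n : ℕ) (hn : 1 ≤ n) (R : ℝ) (φ ψ : EuclideanSpace ℝ (Fin n) → ℝ≥0∞)
    (hφ : Measurable φ) (hψ : Measurable ψ) :
    ∫⁻ x in {x | hV n x < R}, φ x * ∫⁻ y in {y | hV n y < hV n x}, ψ y
    = ∫⁻ y in {y | hV n y < R}, ψ y * ∫⁻ x in {x | hV n x ∈ Ioo (hV n y) R}, φ x := by
  have hm := hV_meas n hn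
  have m1 : ∀ R, MeasurableSet {x | hV n x < R} := fun R => measurableSet_lt hm measurable_const
  have m2 : ∀ b, MeasurableSet {x | hV n x ∈ Ioo b R} := fun b => hm measurableSet_Ioo
  let T : Set (EuclideanSpace ℝ (Fin n) × EuclideanSpace ℝ (Fin n)) :=
    {z | hV n z.1 < R ∧ hV n z.2 < hV n z.1}
  have hT : MeasurableSet T :=
    (measurableSet_lt (hm.comp measurable_fst) measurable_const).inter
      (measurableSet_lt (hm.comp measurable_snd) (hm.comp measurable_fst))
  have hF : Measurable (T.indicator fun z => φ z.1 * ψ z.2) :=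
    Measurable.indicator (by fun_prop) hT
  have hsw := lintegral_lintegral_swap (μ := (volume : Measure (EuclideanSpace ℝ (Fin n))))
    (ν := (volume : Measure (EuclideanSpace ℝ (Fin n))))
    (f := fun x y => T.indicator (fun z => φ z.1 * ψ z.2) (x, y)) hF.aemeasurable
  have L : ∫⁻ x in {x | hV n x < R}, φ x * ∫⁻ y in {y | hV n y < hV n x}, ψ y
      = ∫⁻ x, ∫⁻ y, T.indicator (fun z => φ z.1 * ψ z.2) (x, y) := by
    rw [← lintegral_indicator (m1 R)]
    refine lintegral_congr fun x => ?_
    by_cases hx : hV n x < R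
    · rw [indicator_of_mem (by exact hx), ← lintegral_const_mul _ hψ,
        ← lintegral_indicator (m1 _)]
      refine lintegral_congr fun y => ?_
      by_cases hy : hV n y < hV n x <;> simp [indicator, T, hx, hy]
    · simp [indicator, T, hx]
  have Rr : ∫⁻ y in {y | hV n y < R}, ψ y * ∫⁻ x in {x | hV n x ∈ Ioo (hV n y) R}, φ x
      = ∫⁻ y, ∫⁻ x, T.indicator (fun z => φ z.1 * ψ z.2) (x, y) := by
    rw [← lintegral_indicator (m1 R)]
    refine lintegral_congr fun y => ?_
    by_cases hy : hV n y < R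
    · rw [indicator_of_mem (by exact hy), ← lintegral_const_mul _ hφ,
        ← lintegral_indicator (m2 _)]
      refine lintegral_congr fun x => ?_
      by_cases h1 : hV n y < hV n x <;> by_cases h2 : hV n x < R <;>
        simp [indicator, T, h1, h2, mul_comm]
    · rw [indicator_of_notMem (by exact hy)]
      symm
      refine (lintegral_congr_ae ?_).trans lintegral_zero
      refine Filter.Eventually.of_forall fun x => ?_
      refine indicator_of_notMem ?_ _
      rintro ⟨h1, h2⟩
      exact hy (h2.trans h1)
  rw [L, Rr, hsw]

lemma term_le_iff (q : ℝ) (hq : 0 < q) (A I M : ℝ≥0∞) (hA0 : A ≠ 0) (hA : A ≠ ⊤) :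
    A⁻¹ ^ (1 / q) * I ^ (1 / q) ≤ M ↔ I ≤ M ^ q * A := by
  rw [← ENNReal.mul_rpow_of_nonneg _ _ (by positivity), one_div, ENNReal.rpow_inv_le_iff hq,
    ← ENNReal.div_le_iff hA0 hA, div_eq_mul_inv, mul_comm]

lemma norm_le_iff (n : ℕ) (hn : 1 ≤ n) (q lam : ℝ) (hq : 1 < q)
    (f : EuclideanSpace ℝ (Fin n) → ℝ) (M : ℝ≥0∞) :
    centralMorreyNorm n q lam f ≤ M ↔ ∀ R : ℝ, 0 < R →
      ∫⁻ x in {x | hV n x < R}, ENNReal.ofReal |f x| ^ q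
        ≤ M ^ q * ENNReal.ofReal (R ^ (1 + lam * q)) := by
  have hnupos := hnu_pos n
  have key : ∀ r : ℝ, 0 < r →
      ((((volume (ball (0 : EuclideanSpace ℝ (Fin n)) r)) ^ (1 + lam * q))⁻¹ ^ (1 / q) *
      (∫⁻ x in ball (0 : EuclideanSpace ℝ (Fin n)) r, ENNReal.ofReal |f x| ^ q) ^ (1 / q) ≤ M) ↔
      ∫⁻ x in {x | hV n x < hnu n * r ^ n}, ENNReal.ofReal |f x| ^ q
        ≤ M ^ q * ENNReal.ofReal ((hnu n * r ^ n) ^ (1 + lam * q))) := by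
    intro r hr
    have hpos : 0 < hnu n * r ^ n := by positivity
    rw [vol_ball n hn r hr.le, ball_eq_hV n hn r hr.le, ENNReal.ofReal_rpow_of_pos hpos]
    exact term_le_iff q (by linarith) _ _ _
      (by rw [Ne, ENNReal.ofReal_eq_zero, not_le]; positivity) ENNReal.ofReal_ne_top
  unfold centralMorreyNorm
  simp only [iSup_le_iff]
  constructor
  · intro h R hR
    obtain ⟨r, hr, rfl⟩ := exists_radius n hn R hR.le
    have hr' : 0 < r := by
      rcases hr.eq_or_lt with rfl | h'
      · rw [zero_pow (by omega)] at hR; simp at hR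
      · exact h'
    exact (key r hr').1 (h r hr')
  · intro h r hr
    exact (key r hr).2 (h _ (by positivity))

lemma closedBall_ae (n : ℕ) (hn : 1 ≤ n) (x : EuclideanSpace ℝ (Fin n)) :
    (volume : Measure (EuclideanSpace ℝ (Fin n))).restrict (closedBall 0 ‖x‖)
      = volume.restrict {y | hV n y < hV n x} := by
  have : Nonempty (Fin n) := ⟨⟨0, hn⟩⟩
  have h : {y | hV n y < hV n x} = ball (0 : EuclideanSpace ℝ (Fin n)) ‖x‖ := by
    rw [ball_eq_hV n hn _ (norm_nonneg x), ← hV_eq n hn]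
  rw [h]
  refine Measure.restrict_congr_set ?_
  rw [← ball_union_sphere]
  refine union_ae_eq_left_of_ae_eq_empty ?_
  rw [ae_eq_empty]
  exact Measure.addHaar_sphere _ _ _

lemma hardy_abs_le (n : ℕ) (hn : 1 ≤ n) (f : EuclideanSpace ℝ (Fin n) → ℝ)
    (x : EuclideanSpace ℝ (Fin n)) (hx : 0 < hV n x) :
    ENNReal.ofReal |sphericalHardy n f x|
      ≤ (ENNReal.ofReal (hV n x))⁻¹ * ∫⁻ y in {y | hV n y < hV n x}, ENNReal.ofReal |f y| := by
  unfold sphericalHardy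
  rw [closedBall_ae n hn]
  change ENNReal.ofReal |(hV n x)⁻¹ * _| ≤ _
  rw [abs_mul, ENNReal.ofReal_mul (abs_nonneg _), abs_of_pos (inv_pos.2 hx),
    ENNReal.ofReal_inv_of_pos hx]
  gcongr
  rw [← Real.enorm_eq_ofReal_abs]
  refine (enorm_integral_le_lintegral_enorm _).trans (le_of_eq ?_)
  simp only [Real.enorm_eq_ofReal_abs]

lemma hardy_pt (n : ℕ) (hn : 1 ≤ n) (q lam : ℝ) (hq : 1 < q) (hlam : -1 < lam)
    (f : EuclideanSpace ℝ (Fin n) → ℝ) (hf : Measurable f)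
    (x : EuclideanSpace ℝ (Fin n)) (hx : 0 < hV n x) :
    ENNReal.ofReal |sphericalHardy n f x| ^ q
      ≤ ENNReal.ofReal ((1 + lam) ^ (-(q - 1))) *
        (ENNReal.ofReal (hV n x) ^ (-1 - (-lam * (q - 1))) *
        ∫⁻ y in {y | hV n y < hV n x},
          (ENNReal.ofReal |f y| ^ q * ENNReal.ofReal (hV n y) ^ (-lam * (q - 1)))) := by
  have hm := hV_meas n hn
  have h1l : 0 < 1 + lam := by linarith
  have hq0 : 0 < q := by linarith
  have hq1 : 0 < q - 1 := by linarith
  set s := -lam * (q - 1) with hs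
  set v := hV n x with hv
  set K := ∫⁻ y in {y | hV n y < v},
          (ENNReal.ofReal |f y| ^ q * ENNReal.ofReal (hV n y) ^ s) with hK
  have hconj : q.HolderConjugate (q / (q - 1)) := Real.HolderConjugate.conjExponent hq
  have hol : ∫⁻ y in {y | hV n y < v}, ENNReal.ofReal |f y|
      ≤ K ^ (1 / q) * ENNReal.ofReal (v ^ (lam + 1) / (lam + 1)) ^ (1 / (q / (q - 1))) := by
    have h := ENNReal.lintegral_mul_le_Lp_mul_Lq
      ((volume : Measure (EuclideanSpace ℝ (Fin n))).restrict {y | hV n y < v}) hconj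
      (f := fun y => ENNReal.ofReal |f y| * ENNReal.ofReal (hV n y) ^ (s / q))
      (g := fun y => ENNReal.ofReal (hV n y) ^ (-(s / q)))
      (by fun_prop) (by fun_prop)
    rw [← lint_V_pow n hn v lam hx.le hlam]
    refine le_trans (le_of_eq ?_) (h.trans (le_of_eq ?_))
    · refine lintegral_congr_ae (ae_restrict_of_ae ?_)
      filter_upwards [hV_ae_pos n hn] with y hy
      simp only [Pi.mul_apply]
      rw [mul_assoc, ← ENNReal.rpow_add _ _ (by simpa using hy) ENNReal.ofReal_ne_top]
      simp
    · congr 2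
      · refine lintegral_congr fun y => ?_
        rw [ENNReal.mul_rpow_of_nonneg _ _ hq0.le, ← ENNReal.rpow_mul, div_mul_cancel₀ _ hq0.ne']
      · refine lintegral_congr fun y => ?_
        rw [← ENNReal.rpow_mul]
        congr 1
        rw [hs]; field_simp
  have h2 := (hardy_abs_le n hn f x hx).trans (mul_le_mul_right hol _)
  refine (ENNReal.rpow_le_rpow h2 hq0.le).trans (le_of_eq ?_)
  rw [ENNReal.mul_rpow_of_nonneg _ _ hq0.le, ENNReal.mul_rpow_of_nonneg _ _ hq0.le,
    ← ENNReal.rpow_mul, ← ENNReal.rpow_mul, one_div_mul_cancel hq0.ne', ENNReal.rpow_one]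
  have e1 : 1 / (q / (q - 1)) * q = q - 1 := by field_simp
  have hvp : 0 < v ^ (lam + 1) / (lam + 1) := by
    have : 0 < lam + 1 := by linarith
    positivity
  rw [e1, ENNReal.ofReal_rpow_of_pos hvp, ← ENNReal.ofReal_inv_of_pos hx,
    ENNReal.ofReal_rpow_of_pos (inv_pos.2 hx), ENNReal.ofReal_rpow_of_pos hx, mul_comm K,
    ← mul_assoc, ← mul_assoc, ← ENNReal.ofReal_mul (by positivity),
    ← ENNReal.ofReal_mul (by positivity)]
  congr 2
  rw [Real.div_rpow (by positivity) (by linarith), ← Real.rpow_mul hx.le, Real.inv_rpow hx.le,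
    ← Real.rpow_neg hx.le, Real.rpow_neg h1l.le, add_comm lam 1, mul_div_assoc',
    ← Real.rpow_add hx, div_eq_mul_inv, mul_comm]
  congr 2
  rw [hs]; ring

theorem hardy_upper (n : ℕ) (hn : 1 ≤ n) (q lam : ℝ)
    (hq : 1 < q) (hlam₁ : -(1 / q) ≤ lam) (hlam₂ : lam ≤ 0)
    (f : EuclideanSpace ℝ (Fin n) → ℝ) (hf : Measurable f) :
    centralMorreyNorm n q lam (sphericalHardy n f)
        ≤ ENNReal.ofReal (1 / (1 + lam)) * centralMorreyNorm n q lam f := by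
  have hm := hV_meas n hn
  have hq0 : 0 < q := by linarith
  have hlam : -1 < lam := by
    have : 1 / q < 1 := by rw [div_lt_one hq0]; exact hq
    linarith
  have h1l : 0 < 1 + lam := by linarith
  have hM := (norm_le_iff n hn q lam hq f _).1 le_rfl
  set M := centralMorreyNorm n q lam f with hMdef
  rw [norm_le_iff n hn q lam hq]
  intro R hR
  set s := -lam * (q - 1) with hs
  have hs0 : 0 ≤ s := mul_nonneg (by linarith) (by linarith)
  set c := ENNReal.ofReal ((1 + lam) ^ (-(q - 1))) with hc
  have m1 : ∀ R, MeasurableSet {x | hV n x < R} := fun R => measurableSet_lt hm measurable_const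
  calc ∫⁻ x in {x | hV n x < R}, ENNReal.ofReal |sphericalHardy n f x| ^ q
      ≤ ∫⁻ x in {x | hV n x < R}, c * (ENNReal.ofReal (hV n x) ^ (-1 - s) *
        ∫⁻ y in {y | hV n y < hV n x},
          (ENNReal.ofReal |f y| ^ q * ENNReal.ofReal (hV n y) ^ s)) := by
        refine lintegral_mono_ae (ae_restrict_of_ae ?_)
        filter_upwards [hV_ae_pos n hn] with x hx
        exact hardy_pt n hn q lam hq hlam f hf x hx
    _ = c * ∫⁻ x in {x | hV n x < R}, (ENNReal.ofReal (hV n x) ^ (-1 - s) *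
        ∫⁻ y in {y | hV n y < hV n x},
          (ENNReal.ofReal |f y| ^ q * ENNReal.ofReal (hV n y) ^ s)) :=
        lintegral_const_mul' _ _ ENNReal.ofReal_ne_top
    _ = c * ∫⁻ y in {y | hV n y < R}, (ENNReal.ofReal |f y| ^ q * ENNReal.ofReal (hV n y) ^ s) *
          ∫⁻ x in {x | hV n x ∈ Ioo (hV n y) R}, ENNReal.ofReal (hV n x) ^ (-1 - s) := by
        rw [tonelli n hn R _ _ (by fun_prop) (by fun_prop)]
    _ = c * ∫⁻ y in {y | hV n y < R}, ENNReal.ofReal (R ^ (-s)) * (ENNReal.ofReal |f y| ^ q *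
          ∫⁻ x in {x | hV n x ∈ Ioo (hV n y) R}, ENNReal.ofReal (hV n x) ^ (s - 1)) := by
        congr 1
        refine lintegral_congr_ae ?_
        filter_upwards [ae_restrict_of_ae (hV_ae_pos n hn), ae_restrict_mem (m1 R)] with y hy hyR
        rw [mul_assoc, pow_ident' n hn _ R s hy (le_of_lt hyR) hs0, mul_left_comm]
    _ = c * (ENNReal.ofReal (R ^ (-s)) * ∫⁻ x in {x | hV n x < R},
          ENNReal.ofReal (hV n x) ^ (s - 1) *
          ∫⁻ y in {y | hV n y < hV n x}, ENNReal.ofReal |f y| ^ q) := by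
        rw [lintegral_const_mul' _ _ ENNReal.ofReal_ne_top,
          tonelli n hn R _ _ (by fun_prop) (by fun_prop)]
    _ ≤ c * (ENNReal.ofReal (R ^ (-s)) * ∫⁻ x in {x | hV n x < R},
          M ^ q * ENNReal.ofReal (hV n x) ^ lam) := by
        refine mul_le_mul_right (mul_le_mul_right ?_ _) _
        refine lintegral_mono_ae (ae_restrict_of_ae ?_)
        filter_upwards [hV_ae_pos n hn] with x hx
        refine (mul_le_mul_right (hM _ hx) _).trans (le_of_eq ?_)
        rw [mul_left_comm, ← ENNReal.ofReal_rpow_of_pos hx,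
          ← ENNReal.rpow_add _ _ (by simpa using hx) ENNReal.ofReal_ne_top]
        congr 2
        rw [hs]; ring
    _ = c * (ENNReal.ofReal (R ^ (-s)) * (M ^ q * ENNReal.ofReal (R ^ (lam + 1) / (lam + 1)))) := by
        rw [lintegral_const_mul _ (by fun_prop), lint_V_pow n hn R lam hR.le hlam]
    _ = (ENNReal.ofReal (1 / (1 + lam)) * M) ^ q * ENNReal.ofReal (R ^ (1 + lam * q)) := by
        rw [ENNReal.mul_rpow_of_nonneg _ _ hq0.le, ENNReal.ofReal_rpow_of_pos (by positivity), hc]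
        rw [mul_left_comm _ (M ^ q), mul_left_comm _ (M ^ q), mul_comm _ (M ^ q), mul_assoc,
          ← ENNReal.ofReal_mul (by positivity), ← ENNReal.ofReal_mul (by positivity),
          ← ENNReal.ofReal_mul (by positivity)]
        congr 2
        rw [mul_div_assoc', ← Real.rpow_add hR, one_div, Real.inv_rpow h1l.le,
          ← Real.rpow_neg h1l.le, mul_div_assoc', mul_div_right_comm, add_comm lam 1]
        congr 1
        · rw [div_eq_mul_inv, ← Real.rpow_neg_one (1 + lam), ← Real.rpow_add h1l]
          congr 1; ring
        · congr 1; rw [hs]; ring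

/-- Test function for sharpness. -/
noncomputable def hTest (n : ℕ) (mu : ℝ) (x : EuclideanSpace ℝ (Fin n)) : ℝ :=
  if hV n x < 1 then hV n x ^ mu else 0

lemma hTest_meas (n : ℕ) (hn : 1 ≤ n) (mu : ℝ) : Measurable (hTest n mu) := by
  have hm := hV_meas n hn
  exact Measurable.ite (measurableSet_lt hm measurable_const) (by fun_prop) measurable_const

lemma hTest_nonneg (n : ℕ) (mu : ℝ) (x : EuclideanSpace ℝ (Fin n)) : 0 ≤ hTest n mu x := by
  unfold hTest
  split_ifs
  · exact Real.rpow_nonneg (hV_nonneg n x) _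
  · exact le_rfl

lemma hTest_lint (n : ℕ) (hn : 1 ≤ n) (mu p R : ℝ) (hp : 0 < p) (hmu : -1 < mu * p)
    (hR : 0 ≤ R) :
    ∫⁻ x in {x | hV n x < R}, ENNReal.ofReal |hTest n mu x| ^ p
      = ENNReal.ofReal ((min R 1) ^ (mu * p + 1) / (mu * p + 1)) := by
  have hm := hV_meas n hn
  have m1 : ∀ R, MeasurableSet {x | hV n x < R} := fun R => measurableSet_lt hm measurable_const
  rw [← lint_V_pow n hn (min R 1) (mu * p) (le_min hR zero_le_one) hmu,
    ← lintegral_indicator (m1 _), ← lintegral_indicator (m1 _)]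
  refine lintegral_congr_ae ?_
  filter_upwards [hV_ae_pos n hn] with x hx
  by_cases h1 : hV n x < R <;> by_cases h2 : hV n x < 1 <;>
    simp [indicator, h1, h2, hTest, hp]
  rw [abs_of_pos (Real.rpow_pos_of_pos hx _), ← ENNReal.ofReal_rpow_of_pos hx, ENNReal.rpow_mul]

lemma hTest_hardy (n : ℕ) (hn : 1 ≤ n) (mu : ℝ) (hmu : -1 < mu)
    (x : EuclideanSpace ℝ (Fin n)) (hx : 0 < hV n x) (hx1 : hV n x < 1) :
    sphericalHardy n (hTest n mu) x = 1 / (1 + mu) * hV n x ^ mu := by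
  unfold sphericalHardy
  rw [closedBall_ae n hn]
  change (hV n x)⁻¹ * _ = _
  have h := hTest_lint n hn mu 1 (hV n x) one_pos (by simpa using hmu) hx.le
  simp only [ENNReal.rpow_one, mul_one, abs_of_nonneg (hTest_nonneg n mu _), min_eq_left hx1.le] at h
  have h1 : 0 < mu + 1 := by linarith
  rw [integral_eq_lintegral_of_nonneg_ae (Filter.Eventually.of_forall (hTest_nonneg n mu))
    (hTest_meas n hn mu).aestronglyMeasurable, h, ENNReal.toReal_ofReal (by positivity),
    Real.rpow_add_one hx.ne', add_comm mu 1]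
  have : (1 + mu) ≠ 0 := by linarith
  field_simp

theorem hardy_lower (n : ℕ) (hn : 1 ≤ n) (q lam mu : ℝ)
    (hq : 1 < q) (hlam₁ : -(1 / q) ≤ lam) (hmu : lam < mu) (C : ℝ≥0∞)
    (hC : ∀ f : EuclideanSpace ℝ (Fin n) → ℝ, Measurable f → centralMorreyNorm n q lam f < ⊤ →
        centralMorreyNorm n q lam (sphericalHardy n f) ≤ C * centralMorreyNorm n q lam f) :
    ENNReal.ofReal (1 / (1 + mu)) ≤ C := by
  have hm := hV_meas n hn
  have hq0 : 0 < q := by linarith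
  have h1q : 1 / q < 1 := by rw [div_lt_one hq0]; exact hq
  have hmu1 : -1 < mu := by linarith
  have h1m : 0 < 1 + mu := by linarith
  have hlq : 0 ≤ 1 + lam * q := by
    have := mul_le_mul_of_nonneg_right hlam₁ hq0.le
    rw [neg_mul, one_div_mul_cancel hq0.ne'] at this
    linarith
  have hlm : lam * q < mu * q := mul_lt_mul_of_pos_right hmu hq0
  have hmq : 0 < mu * q + 1 := by linarith
  set N : ℝ≥0∞ := ENNReal.ofReal (1 / (mu * q + 1)) ^ (1 / q) with hN
  have hNq : N ^ q = ENNReal.ofReal (1 / (mu * q + 1)) := by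
    rw [hN, ← ENNReal.rpow_mul, one_div_mul_cancel hq0.ne', ENNReal.rpow_one]
  have hNq0 : N ^ q ≠ 0 := by
    rw [hNq, Ne, ENNReal.ofReal_eq_zero, not_le]; positivity
  have hNqt : N ^ q ≠ ⊤ := by rw [hNq]; exact ENNReal.ofReal_ne_top
  have hNt : N < ⊤ := ENNReal.rpow_lt_top_of_nonneg (by positivity) ENNReal.ofReal_ne_top
  have hnorm : centralMorreyNorm n q lam (hTest n mu) ≤ N := by
    rw [norm_le_iff n hn q lam hq]
    intro R hR
    rw [hTest_lint n hn mu q R hq0 (by linarith) hR.le, hNq, ← ENNReal.ofReal_mul (by positivity)]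
    refine ENNReal.ofReal_le_ofReal ?_
    rw [div_eq_mul_one_div, mul_comm]
    refine mul_le_mul_of_nonneg_left ?_ (by positivity)
    rcases le_total R 1 with h | h
    · rw [min_eq_left h]
      exact Real.rpow_le_rpow_of_exponent_ge hR h (by linarith)
    · rw [min_eq_right h, Real.one_rpow]
      exact Real.one_le_rpow h hlq
  have h1 := (hC _ (hTest_meas n hn mu) (hnorm.trans_lt hNt)).trans (mul_le_mul_right hnorm C)
  have h2 := (norm_le_iff n hn q lam hq _ _).1 h1 1 one_pos
  have h3 : ∫⁻ x in {x | hV n x < 1}, ENNReal.ofReal |sphericalHardy n (hTest n mu) x| ^ q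
      = ENNReal.ofReal (1 / (1 + mu)) ^ q * N ^ q := by
    have h4 := lint_V_pow n hn 1 (mu * q) zero_le_one (by linarith)
    rw [Real.one_rpow, ← hNq] at h4
    rw [← h4, ← lintegral_const_mul _ (by fun_prop)]
    refine lintegral_congr_ae ?_
    filter_upwards [ae_restrict_of_ae (hV_ae_pos n hn),
      ae_restrict_mem (measurableSet_lt hm measurable_const)] with x hx hx1
    rw [hTest_hardy n hn mu hmu1 x hx hx1, abs_of_pos (by positivity),
      ENNReal.ofReal_mul (by positivity), ENNReal.mul_rpow_of_nonneg _ _ hq0.le,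
      ← ENNReal.ofReal_rpow_of_pos hx, ENNReal.rpow_mul]
  rw [h3, Real.one_rpow, ENNReal.ofReal_one, mul_one, ENNReal.mul_rpow_of_nonneg _ _ hq0.le,
    ENNReal.mul_le_mul_iff_left hNq0 hNqt, ENNReal.rpow_le_rpow_iff hq0] at h2
  exact h2

/-- For `1 < q < ∞` and `-1/q ≤ λ ≤ 0`, the spherical Hardy operator satisfies
`‖𝓗f‖_{𝓑^{q,λ}} ≤ (1/(1+λ)) ‖f‖_{𝓑^{q,λ}}`, and `1/(1+λ)` is its exact operator norm
on the `λ`-central Morrey space. -/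
theorem sphericalHardy_centralMorrey_norm (n : ℕ) (hn : 1 ≤ n) (q lam : ℝ)
    (hq : 1 < q) (hlam₁ : -(1 / q) ≤ lam) (hlam₂ : lam ≤ 0) :
    (∀ f : EuclideanSpace ℝ (Fin n) → ℝ, Measurable f → centralMorreyNorm n q lam f < ⊤ →
      centralMorreyNorm n q lam (sphericalHardy n f)
        ≤ ENNReal.ofReal (1 / (1 + lam)) * centralMorreyNorm n q lam f) ∧
    (∀ C : ℝ≥0∞,
      (∀ f : EuclideanSpace ℝ (Fin n) → ℝ, Measurable f → centralMorreyNorm n q lam f < ⊤ →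
        centralMorreyNorm n q lam (sphericalHardy n f) ≤ C * centralMorreyNorm n q lam f) →
      ENNReal.ofReal (1 / (1 + lam)) ≤ C) := by
  refine ⟨fun f hf _ => hardy_upper n hn q lam hq hlam₁ hlam₂ f hf, fun C hC => ?_⟩
  have h1q : 1 / q < 1 := by rw [div_lt_one (by linarith)]; exact hq
  have h1l : 1 + lam ≠ 0 := by linarith
  have ht : Filter.Tendsto (fun mu : ℝ => ENNReal.ofReal (1 / (1 + mu)))
      (nhdsWithin lam (Ioi lam)) (nhds (ENNReal.ofReal (1 / (1 + lam)))) := by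
    have hc : ContinuousAt (fun mu : ℝ => 1 / (1 + mu)) lam :=
      ContinuousAt.div (by fun_prop) (by fun_prop) h1l
    exact (ENNReal.tendsto_ofReal hc.tendsto).mono_left nhdsWithin_le_nhds
  refine le_of_tendsto ht ?_
  filter_upwards [self_mem_nhdsWithin] with mu hmu
  exact hardy_lower n hn q lam mu hq hlam₁ hmu C hC
end

section
/- Let 1 < q < ∞ and -1/q < λ < 1/n. The spherical Hardy operator 𝓗 satisfies ‖𝓗f‖_{CMO^{q,λ}(ℝⁿ)} ≤ (1/(1+λ)) ‖f‖_{CMO^{q,λ}(ℝⁿ)}, and the operator norm of 𝓗 on CMO^{q,λ}(ℝⁿ) equals 1/(1+λ); in particular, on CMO^q(ℝⁿ) (the case λ = 0) the operator norm equals 1. -/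
open MeasureTheory Set ENNReal Metric

/-- The average of `f` over the ball `B(0,r)`. -/
noncomputable def ballAvg (n : ℕ) (f : EuclideanSpace ℝ (Fin n) → ℝ) (r : ℝ) : ℝ :=
  (∫ y in ball (0 : EuclideanSpace ℝ (Fin n)) r, f y) /
    (volume (ball (0 : EuclideanSpace ℝ (Fin n)) r)).toReal

/-- The `λ`-central bounded mean oscillation norm
`‖f‖_{CMO^{q,λ}} = sup_{r>0} (|B(0,r)|^{-(1+λq)} ∫_{B(0,r)} |f - f_B|^q)^{1/q}`. -/
noncomputable def cmoNorm (n : ℕ) (q lam : ℝ)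
    (f : EuclideanSpace ℝ (Fin n) → ℝ) : ℝ≥0∞ :=
  ⨆ (r : ℝ) (_ : 0 < r),
    ((volume (ball (0 : EuclideanSpace ℝ (Fin n)) r)) ^ (1 + lam * q))⁻¹ ^ (1 / q) *
      (∫⁻ x in ball (0 : EuclideanSpace ℝ (Fin n)) r,
        ENNReal.ofReal |f x - ballAvg n f r| ^ q) ^ (1 / q)

lemma mp_polar {E : Type*} [NormedAddCommGroup E] [NormedSpace ℝ E] [MeasurableSpace E]
    [BorelSpace E] [FiniteDimensional ℝ E] [Nontrivial E] (μ : Measure E) [μ.IsAddHaarMeasure] :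
    MeasurePreserving (fun p : sphere (0 : E) 1 × Ioi (0 : ℝ) => p.2.1 • p.1.1)
      (μ.toSphere.prod (Measure.volumeIoiPow (Module.finrank ℝ E - 1))) μ := by
  have h1 := μ.measurePreserving_homeomorphUnitSphereProd
  have h2 : MeasurePreserving (homeomorphUnitSphereProd E).symm
      (μ.toSphere.prod (Measure.volumeIoiPow (Module.finrank ℝ E - 1)))
      (μ.comap ((↑) : ({0}ᶜ : Set E) → E)) :=
    MeasurePreserving.symm (homeomorphUnitSphereProd E).toMeasurableEquiv h1
  have h3 : MeasurePreserving ((↑) : ({0}ᶜ : Set E) → E) (μ.comap ((↑) : ({0}ᶜ : Set E) → E)) μ := by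
    refine ⟨measurable_subtype_coe, ?_⟩
    rw [map_comap_subtype_coe (measurableSet_singleton _).compl, restrict_compl_singleton]
  exact h3.comp h2

lemma mp_swapAngles {A B : Type*} [MeasurableSpace A] [MeasurableSpace B]
    (σ : Measure A) (τ : Measure B) [SigmaFinite σ] [SigmaFinite τ] :
    MeasurePreserving (fun p : (A × B) × (A × B) => ((p.2.1, p.1.2), (p.1.1, p.2.2)))
      ((σ.prod τ).prod (σ.prod τ)) ((σ.prod τ).prod (σ.prod τ)) := by
  have hm : Measurable (fun p : (A × B) × (A × B) => ((p.2.1, p.1.2), (p.1.1, p.2.2))) := by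
    fun_prop
  refine ⟨hm, ?_⟩
  refine Measure.ext_of_lintegral _ fun g hg => ?_
  rw [lintegral_map hg hm]
  have key : ∀ g : (A × B) × (A × B) → ℝ≥0∞, Measurable g →
      ∫⁻ p, g p ∂((σ.prod τ).prod (σ.prod τ)) =
      ∫⁻ a, ∫⁻ c, ∫⁻ b, ∫⁻ d, g ((a, b), (c, d)) ∂τ ∂τ ∂σ ∂σ := by
    intro g hg
    rw [lintegral_prod _ hg.aemeasurable, lintegral_prod _ (by fun_prop)]
    refine lintegral_congr fun a => ?_
    have : ∀ b, ∫⁻ (y : A × B), g ((a, b), y) ∂σ.prod τ = ∫⁻ c, ∫⁻ d, g ((a,b),(c,d)) ∂τ ∂σ :=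
      fun b => lintegral_prod _ (by fun_prop)
    simp_rw [this]
    rw [lintegral_lintegral_swap]
    refine Measurable.aemeasurable ?_
    simp only [Function.uncurry_def]
    exact Measurable.lintegral_prod_right' (f := fun q : (B × A) × B => g ((a, q.1.1), (q.1.2, q.2))) (by fun_prop)
  rw [key _ hg]
  refine (key (fun p => g ((p.2.1, p.1.2), (p.1.1, p.2.2))) (by fun_prop)).trans ?_
  rw [lintegral_lintegral_swap]
  refine Measurable.aemeasurable ?_
  simp only [Function.uncurry_def]
  refine Measurable.lintegral_prod_right' (f := fun q : (A × A) × B => ∫⁻ d, g ((q.1.2, q.2), (q.1.1, d)) ∂τ) ?_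
  exact Measurable.lintegral_prod_right' (f := fun q : ((A × A) × B) × B => g ((q.1.1.2, q.1.2), (q.1.1.1, q.2))) (by fun_prop)

noncomputable def swapT {E : Type*} [NormedAddCommGroup E] [NormedSpace ℝ E] (p : E × E) : E × E :=
  ((‖p.1‖ * ‖p.2‖⁻¹) • p.2, (‖p.2‖ * ‖p.1‖⁻¹) • p.1)

lemma mp_swapT {E : Type*} [NormedAddCommGroup E] [NormedSpace ℝ E] [MeasurableSpace E]
    [BorelSpace E] [FiniteDimensional ℝ E] [Nontrivial E] (μ : Measure E) [μ.IsAddHaarMeasure] :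
    MeasurePreserving (swapT (E := E)) (μ.prod μ) (μ.prod μ) := by
  have hm : Measurable (swapT (E := E)) := by
    unfold swapT
    fun_prop
  refine ⟨hm, ?_⟩
  have hP := (mp_polar μ).prod (mp_polar μ)
  have hQ := mp_swapAngles μ.toSphere (Measure.volumeIoiPow (Module.finrank ℝ E - 1))
  have h1 := (hP.comp hQ).map_eq
  have h2 := hP.map_eq
  conv_lhs => rw [← h2]
  rw [Measure.map_map hm hP.measurable]
  rw [← h1]
  congr 1
  ext1 p
  obtain ⟨⟨a, b⟩, ⟨c, d⟩⟩ := p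
  have ha : ‖a.1‖ = 1 := by simp
  have hc : ‖c.1‖ = 1 := by simp
  have hb : 0 < b.1 := b.2
  have hd : 0 < d.1 := d.2
  simp only [Function.comp, Prod.map, swapT, norm_smul, ha, hc, smul_smul, Real.norm_eq_abs, abs_of_pos hb, abs_of_pos hd]
  congr 2 <;> field_simp

lemma mp_swapT_restrict {E : Type*} [NormedAddCommGroup E] [NormedSpace ℝ E] [MeasurableSpace E]
    [BorelSpace E] [FiniteDimensional ℝ E] [Nontrivial E] (μ : Measure E) [μ.IsAddHaarMeasure]
    (r s : ℝ) :
    MeasurePreserving (swapT (E := E)) ((μ.restrict (ball 0 r)).prod (μ.restrict (ball 0 s)))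
      ((μ.restrict (ball 0 r)).prod (μ.restrict (ball 0 s))) := by
  rw [Measure.prod_restrict]
  have h := (mp_swapT μ).restrict_preimage (s := (ball 0 r) ×ˢ (ball 0 s)) (measurableSet_ball.prod measurableSet_ball)
  convert h using 1
  refine Measure.restrict_congr_set ?_
  have h0 : ∀ᵐ x ∂μ, x ≠ 0 := by
    simp [ae_iff]
  filter_upwards [Measure.quasiMeasurePreserving_fst.ae h0, Measure.quasiMeasurePreserving_snd.ae h0] with p h1 h2
  have h1' : ‖p.1‖ ≠ 0 := by simpa using h1
  have h2' : ‖p.2‖ ≠ 0 := by simpa using h2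
  rw [eq_iff_iff]
  change p ∈ (ball (0 : E) r) ×ˢ (ball (0 : E) s) ↔ swapT p ∈ (ball (0 : E) r) ×ˢ (ball (0 : E) s)
  simp [mem_prod, swapT, norm_smul, h1', h2']

lemma weighted_holder {α : Type*} [MeasurableSpace α] (μ : Measure α) (w h : α → ℝ≥0∞)
    (hw : AEMeasurable w μ) (hh : AEMeasurable h μ) (hw0 : ∀ᵐ x ∂μ, w x ≠ 0)
    (hwt : ∀ᵐ x ∂μ, w x ≠ ⊤) (q : ℝ) (hq : 1 < q) :
    (∫⁻ x, h x ∂μ) ^ q ≤ (∫⁻ x, w x ∂μ) ^ (q - 1) * ∫⁻ x, w x ^ (1 - q) * h x ^ q ∂μ := by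
  have hq0 : 0 < q := by linarith
  have hc : (q.conjExponent).HolderConjugate q := (Real.HolderConjugate.conjExponent hq).symm
  set p := q.conjExponent with hp
  have hp0 : 0 < p := hc.pos
  have hpq : 1 / p * q = q - 1 := by
    have := hc.inv_add_inv_eq_one
    field_simp at this ⊢
    linarith
  have h1 := ENNReal.lintegral_mul_le_Lp_mul_Lq μ hc (hw.pow_const (1 / p))
    ((hw.pow_const (-(1 / p))).mul hh)
  have h2 : ∫⁻ x, ((fun x => w x ^ (1 / p)) * ((fun x => w x ^ (-(1 / p))) * h)) x ∂μ = ∫⁻ x, h x ∂μ := by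
    refine lintegral_congr_ae ?_
    filter_upwards [hw0, hwt] with x h0 ht
    simp only [Pi.mul_apply]
    rw [← mul_assoc, ← ENNReal.rpow_add _ _ h0 ht]
    simp
  have h3 : ∫⁻ x, (w x ^ (1 / p)) ^ p ∂μ = ∫⁻ x, w x ∂μ := by
    refine lintegral_congr fun x => ?_
    rw [← ENNReal.rpow_mul, one_div_mul_cancel hp0.ne', ENNReal.rpow_one]
  have h4 : ∫⁻ x, (((fun x => w x ^ (-(1 / p))) * h) x) ^ q ∂μ = ∫⁻ x, w x ^ (1 - q) * h x ^ q ∂μ := by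
    refine lintegral_congr fun x => ?_
    simp only [Pi.mul_apply]
    rw [ENNReal.mul_rpow_of_nonneg _ _ hq0.le, ← ENNReal.rpow_mul]
    congr 2
    linarith
  rw [h2, h3, h4] at h1
  calc (∫⁻ x, h x ∂μ) ^ q ≤ _ := ENNReal.rpow_le_rpow h1 hq0.le
    _ = _ := by
      rw [ENNReal.mul_rpow_of_nonneg _ _ hq0.le, ← ENNReal.rpow_mul, ← ENNReal.rpow_mul, hpq,
        one_div_mul_cancel hq0.ne', ENNReal.rpow_one]

section
variable {n : ℕ}

local notation "𝔼" => EuclideanSpace ℝ (Fin n)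

lemma vol_ball_mul {t : ℝ} (ht : 0 < t) (r : ℝ) :
    volume (ball (0 : 𝔼) (t * r)) = ENNReal.ofReal t ^ n * volume (ball (0 : 𝔼) r) := by
  rw [Measure.addHaar_ball_mul_of_pos _ _ ht]
  simp [ENNReal.ofReal_pow ht.le]

lemma lint_scale {t : ℝ} (ht : 0 < t) (r : ℝ) (g : 𝔼 → ℝ≥0∞) (hg : Measurable g) :
    ENNReal.ofReal t ^ n * ∫⁻ x in ball (0 : 𝔼) r, g (t • x) = ∫⁻ x in ball (0 : 𝔼) (t * r), g x := by
  have hm : Measurable (fun x : 𝔼 => t • x) := by fun_prop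
  have h1 := lintegral_map (μ := volume) (f := (ball (0 : 𝔼) (t * r)).indicator g)
    (hg.indicator measurableSet_ball) hm
  rw [Measure.map_addHaar_smul _ ht.ne', lintegral_smul_measure, lintegral_indicator measurableSet_ball] at h1
  have h2 : ∀ x, (ball (0 : 𝔼) (t * r)).indicator g (t • x) =
      (ball (0 : 𝔼) r).indicator (fun x => g (t • x)) x := by
    intro x
    by_cases hx : ‖x‖ < r <;> simp [indicator, norm_smul, abs_of_pos ht, ht]
  simp_rw [h2] at h1
  rw [lintegral_indicator measurableSet_ball] at h1
  rw [← h1]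
  simp only [finrank_euclideanSpace, Fintype.card_fin, smul_eq_mul]
  rw [← mul_assoc, ← ENNReal.ofReal_pow ht.le, ← ENNReal.ofReal_mul (by positivity), abs_of_pos (by positivity),
    mul_inv_cancel₀ (by positivity)]
  simp

lemma vol_pos (r : ℝ) (hr : 0 < r) : volume (ball (0 : 𝔼) r) ≠ 0 := (measure_ball_pos _ _ hr).ne'
lemma vol_fin (r : ℝ) : volume (ball (0 : 𝔼) r) ≠ ⊤ := measure_ball_lt_top.ne

lemma pow_int_real (hn : 1 ≤ n) {a : ℝ} (ha : -1 < a) :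
    IntegrableOn (fun y : 𝔼 => ‖y‖ ^ (n * a)) (ball 0 1) ∧
    ∫ y in ball (0 : 𝔼) 1, ‖y‖ ^ (n * a) = (1 / (1 + a)) * (volume (ball (0 : 𝔼) 1)).toReal := by
  have : Nonempty (Fin n) := ⟨⟨0, hn⟩⟩
  have hn0 : (0 : ℝ) < n := by exact_mod_cast hn
  have e : ∀ y : ℝ, 0 < y → y ^ (n - 1) • y ^ (n * a) = y ^ ((n : ℝ) - 1 + n * a) := by
    intro y hy
    rw [smul_eq_mul, ← Real.rpow_natCast, ← Real.rpow_add hy]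
    push_cast [hn]
    rfl
  have hexp : -1 < (n : ℝ) - 1 + n * a := by nlinarith
  constructor
  · rw [integrableOn_fun_norm_addHaar (μ := volume) (f := fun y : ℝ => y ^ (n * a))]
    have := (intervalIntegral.intervalIntegrable_rpow' (a := 0) (b := 1) hexp)
    rw [intervalIntegrable_iff_integrableOn_Ioo_of_le zero_le_one] at this
    refine this.congr_fun ?_ measurableSet_Ioo
    intro y hy
    simp only [finrank_euclideanSpace, Fintype.card_fin]
    exact (e y hy.1).symm
  · have h := integral_fun_norm_addHaar (volume : Measure 𝔼) (fun y : ℝ => (Iio (1 : ℝ)).indicator (fun y => y ^ (n * a)) y)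
    have h2 : ∀ x : 𝔼, (Iio (1 : ℝ)).indicator (fun y => y ^ (n * a)) ‖x‖ = (ball (0 : 𝔼) 1).indicator (fun x => ‖x‖ ^ (n * a)) x := by
      intro x
      simp [indicator]
    simp_rw [h2] at h
    rw [integral_indicator measurableSet_ball] at h
    rw [h]
    have h3 : ∫ y in Ioi (0 : ℝ), y ^ (Module.finrank ℝ 𝔼 - 1) • (Iio (1 : ℝ)).indicator (fun y => y ^ (n * a)) y
        = ∫ y in (0:ℝ)..1, y ^ ((n : ℝ) - 1 + n * a) := by
      rw [intervalIntegral.integral_of_le zero_le_one, integral_Ioc_eq_integral_Ioo, ← integral_indicator measurableSet_Ioi,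
        ← integral_indicator measurableSet_Ioo]
      congr 1
      ext y
      by_cases h0 : 0 < y
      · by_cases h1 : y < 1
        · have := e y h0
          simp only [smul_eq_mul] at this
          simp [h0, h1, this]
        · simp [h1]
      · simp [h0]
    rw [h3, integral_rpow (Or.inl hexp)]
    have : (n : ℝ) - 1 + n * a + 1 = n * (1 + a) := by ring
    rw [this, Real.zero_rpow (by nlinarith)]
    have h1a : 1 + a ≠ 0 := by linarith
    simp only [finrank_euclideanSpace, Fintype.card_fin, Measure.real, Real.one_rpow, smul_eq_mul, nsmul_eq_mul]
    field_simp
    simp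

lemma pow_lint (hn : 1 ≤ n) {a : ℝ} (ha : -1 < a) :
    ∫⁻ y in ball (0 : 𝔼) 1, ENNReal.ofReal ‖y‖ ^ (n * a) =
      ENNReal.ofReal (1 / (1 + a)) * volume (ball (0 : 𝔼) 1) := by
  obtain ⟨h1, h2⟩ := pow_int_real hn ha
  have : Nonempty (Fin n) := ⟨⟨0, hn⟩⟩
  have h3 := ofReal_integral_eq_lintegral_ofReal h1 (.of_forall fun y => by positivity)
  rw [h2, ENNReal.ofReal_mul (by have : 0 < 1 + a := by linarith
                                 positivity), ENNReal.ofReal_toReal (vol_fin 1)] at h3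
  rw [h3]
  have h0 : ∀ᵐ x : 𝔼 ∂(volume.restrict (ball 0 1)), x ≠ 0 := ae_restrict_of_ae (by simp [ae_iff])
  refine lintegral_congr_ae ?_
  filter_upwards [h0] with x hx
  rw [ENNReal.ofReal_rpow_of_pos (by simpa using hx)]

end

section
variable {n : ℕ}

local notation "𝔼" => EuclideanSpace ℝ (Fin n)

lemma term_le_iff_s7 {q lam r : ℝ} (hq : 1 < q) (hr : 0 < r) (I M : ℝ≥0∞) :
    ((volume (ball (0 : 𝔼) r)) ^ (1 + lam * q))⁻¹ ^ (1 / q) * I ^ (1 / q) ≤ M ↔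
      I ≤ M ^ q * volume (ball (0 : 𝔼) r) ^ (1 + lam * q) := by
  have hq0 : 0 < q := by linarith
  have h0 : volume (ball (0 : 𝔼) r) ^ (1 + lam * q) ≠ 0 :=
    (ENNReal.rpow_pos (pos_iff_ne_zero.2 (vol_pos r hr)) (vol_fin r)).ne'
  have ht : volume (ball (0 : 𝔼) r) ^ (1 + lam * q) ≠ ⊤ :=
    ENNReal.rpow_ne_top_of_ne_zero (vol_pos r hr) (vol_fin r)
  rw [← ENNReal.mul_rpow_of_nonneg _ _ (by positivity), one_div, ENNReal.rpow_inv_le_iff hq0,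
    ENNReal.inv_mul_le_iff h0 ht, mul_comm]

lemma cmo_le_iff {q lam : ℝ} (hq : 1 < q) (f : 𝔼 → ℝ) (M : ℝ≥0∞) :
    cmoNorm n q lam f ≤ M ↔ ∀ r > 0, ∫⁻ x in ball (0 : 𝔼) r, ENNReal.ofReal |f x - ballAvg n f r| ^ q
      ≤ M ^ q * volume (ball (0 : 𝔼) r) ^ (1 + lam * q) := by
  unfold cmoNorm
  simp only [iSup_le_iff]
  refine forall_congr' fun r => forall_congr' fun hr => ?_
  exact term_le_iff_s7 hq hr _ _

lemma ballAvg_scale (f : 𝔼 → ℝ) {t r : ℝ} (ht : 0 < t) :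
    ballAvg n f (t * r) = (volume (ball (0 : 𝔼) r)).toReal⁻¹ * ∫ x in ball (0 : 𝔼) r, f (t • x) := by
  rw [Measure.setIntegral_comp_smul_of_pos _ _ _ ht, _root_.smul_ball ht.ne', ballAvg, vol_ball_mul ht]
  simp only [smul_zero, Real.norm_eq_abs, abs_of_pos ht, finrank_euclideanSpace, Fintype.card_fin, smul_eq_mul,
    ENNReal.toReal_mul, ENNReal.toReal_pow, ENNReal.toReal_ofReal ht.le]
  rw [div_eq_mul_inv, mul_inv]
  ring

lemma hardy_eq (hn : 1 ≤ n) (f : 𝔼 → ℝ) {x : 𝔼} (hx : x ≠ 0) :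
    sphericalHardy n f x = (volume (ball (0 : 𝔼) 1)).toReal⁻¹ * ∫ y in ball (0 : 𝔼) 1, f (‖x‖ • y) := by
  have : Nonempty (Fin n) := ⟨⟨0, hn⟩⟩
  rw [← ballAvg_scale f (norm_pos_iff.2 hx), sphericalHardy, ballAvg, mul_one, div_eq_mul_inv, mul_comm]
  congr 1
  have : (closedBall (0 : 𝔼) ‖x‖) =ᵐ[volume] ball 0 ‖x‖ := by
    refine (ae_eq_of_subset_of_measure_ge ball_subset_closedBall ?_ measurableSet_ball.nullMeasurableSet
      measure_closedBall_lt_top.ne).symm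
    rw [Measure.addHaar_closedBall_eq_addHaar_ball]
  rw [Measure.restrict_congr_set this]

lemma lq_fin {q lam : ℝ} (hq : 1 < q) {f : 𝔼 → ℝ} (hf : Measurable f) (hN : cmoNorm n q lam f < ⊤)
    {r : ℝ} (hr : 0 < r) : ∫⁻ x in ball (0 : 𝔼) r, ENNReal.ofReal |f x| ^ q < ⊤ := by
  have hq0 : 0 < q := by linarith
  have h1 := (cmo_le_iff (lam := lam) hq f _).1 le_rfl r hr
  have ht : volume (ball (0 : 𝔼) r) ^ (1 + lam * q) ≠ ⊤ :=
    ENNReal.rpow_ne_top_of_ne_zero (vol_pos r hr) (vol_fin r)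
  have h2 := h1.trans_lt (ENNReal.mul_lt_top (ENNReal.rpow_lt_top_of_nonneg hq0.le hN.ne) ht.lt_top)
  have e0 : ENNReal.ofReal q ≠ 0 := by simpa using hq0
  have : IsFiniteMeasure (volume.restrict (ball (0 : 𝔼) r)) := ⟨by simpa using (vol_fin r).lt_top⟩
  have h3 : MemLp (fun x => f x - ballAvg n f r) (ENNReal.ofReal q) (volume.restrict (ball (0 : 𝔼) r)) := by
    refine ⟨by fun_prop, ?_⟩
    rw [eLpNorm_lt_top_iff_lintegral_rpow_enorm_lt_top e0 (by simp), ENNReal.toReal_ofReal hq0.le]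
    simpa only [Real.enorm_eq_ofReal_abs] using h2
  have h4 := h3.add (memLp_const (ballAvg n f r))
  have h5 := h4.2
  rw [eLpNorm_lt_top_iff_lintegral_rpow_enorm_lt_top e0 (by simp), ENNReal.toReal_ofReal hq0.le] at h5
  simpa [Real.enorm_eq_ofReal_abs] using h5

lemma integrable_prod_aux (hn : 1 ≤ n) {q : ℝ} (hq : 1 < q) {f : 𝔼 → ℝ} (hf : Measurable f)
    {r : ℝ} (hI : ∫⁻ x in ball (0 : 𝔼) r, ENNReal.ofReal |f x| ^ q < ⊤) :
    Integrable (fun p : 𝔼 × 𝔼 => f (‖p.2‖ • p.1))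
      ((volume.restrict (ball (0 : 𝔼) r)).prod (volume.restrict (ball (0 : 𝔼) 1))) := by
  have hq0 : 0 < q := by linarith
  have : Nonempty (Fin n) := ⟨⟨0, hn⟩⟩
  have hm : Measurable (fun p : 𝔼 × 𝔼 => f (‖p.2‖ • p.1)) := by fun_prop
  refine ⟨hm.aestronglyMeasurable, ?_⟩
  unfold HasFiniteIntegral
  rw [lintegral_prod_symm _ hm.enorm.aemeasurable]
  set K := volume (ball (0 : 𝔼) r) ^ (q - 1) * ∫⁻ x in ball (0 : 𝔼) r, ENNReal.ofReal |f x| ^ q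
  have hK : K ≠ ⊤ := ENNReal.mul_ne_top (ENNReal.rpow_ne_top_of_nonneg (by linarith) (vol_fin r)) hI.ne
  have h0 : ∀ᵐ x : 𝔼 ∂(volume.restrict (ball 0 1)), x ≠ 0 := ae_restrict_of_ae (by simp [ae_iff])
  have key : ∀ᵐ y : 𝔼 ∂(volume.restrict (ball 0 1)), ∫⁻ x in ball (0 : 𝔼) r, ‖f (‖y‖ • x)‖ₑ ≤
      K ^ (1 / q) * ENNReal.ofReal ‖y‖ ^ (n * (-(1 / q))) := by
    filter_upwards [h0, ae_restrict_mem measurableSet_ball] with y hy hy1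
    have hy0 : 0 < ‖y‖ := norm_pos_iff.2 hy
    have hy1 : ‖y‖ < 1 := by simpa using hy1
    have hH := weighted_holder (volume.restrict (ball (0 : 𝔼) r)) (fun _ => 1) (fun x => ‖f (‖y‖ • x)‖ₑ)
      (by fun_prop) (by fun_prop) (by simp) (by simp) q hq
    simp only [lintegral_const, Measure.restrict_apply_univ, ENNReal.one_rpow, one_mul] at hH
    have hS := lint_scale hy0 r (fun x => ‖f x‖ₑ ^ q) (by fun_prop)
    have hle : ∫⁻ x in ball (0 : 𝔼) (‖y‖ * r), ‖f x‖ₑ ^ q ≤ ∫⁻ x in ball (0 : 𝔼) r, ENNReal.ofReal |f x| ^ q := by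
      simp only [Real.enorm_eq_ofReal_abs]
      refine lintegral_mono_set ?_
      intro z hz
      simp only [mem_ball, dist_zero_right] at hz ⊢
      have : 0 < r := by
        by_contra h
        have := norm_nonneg z
        nlinarith
      nlinarith
    have ho0 : ENNReal.ofReal ‖y‖ ≠ 0 := by simpa using hy
    have hp0 : ENNReal.ofReal ‖y‖ ^ n ≠ 0 := pow_ne_zero _ ho0
    have hpt : ENNReal.ofReal ‖y‖ ^ n ≠ ⊤ := by simp
    have h5 : ∫⁻ x in ball (0 : 𝔼) r, ‖f (‖y‖ • x)‖ₑ ^ q ≤ (ENNReal.ofReal ‖y‖ ^ n)⁻¹ *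
        ∫⁻ x in ball (0 : 𝔼) r, ENNReal.ofReal |f x| ^ q := by
      rw [← ENNReal.mul_le_iff_le_inv hp0 hpt, hS]
      exact hle
    have h6 : (∫⁻ x in ball (0 : 𝔼) r, ‖f (‖y‖ • x)‖ₑ) ^ q ≤ K * (ENNReal.ofReal ‖y‖ ^ n)⁻¹ := by
      refine hH.trans ?_
      calc _ ≤ _ := mul_le_mul_right h5 _
        _ = _ := by simp only [K]; ring
    rw [← ENNReal.le_rpow_inv_iff hq0, ENNReal.mul_rpow_of_nonneg _ _ (by positivity)] at h6
    refine h6.trans (le_of_eq ?_)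
    rw [one_div, mul_neg, ENNReal.rpow_neg, ENNReal.rpow_mul, ENNReal.rpow_natCast, ENNReal.inv_rpow]
  refine (lintegral_mono_ae key).trans_lt ?_
  rw [lintegral_const_mul _ (by fun_prop), pow_lint hn (by rw [neg_lt_neg_iff, div_lt_one hq0]; exact hq)]
  refine ENNReal.mul_lt_top (ENNReal.rpow_lt_top_of_nonneg (by positivity) hK) ?_
  exact ENNReal.mul_lt_top ENNReal.ofReal_lt_top (vol_fin 1).lt_top

end

section
variable {n : ℕ}

local notation "𝔼" => EuclideanSpace ℝ (Fin n)

/-- The average of `f` over `B(0, ‖y‖ r)`, written as an integral over `B(0, r)`. -/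
noncomputable def avgS (n : ℕ) (f : EuclideanSpace ℝ (Fin n) → ℝ) (r : ℝ)
    (y : EuclideanSpace ℝ (Fin n)) : ℝ :=
  (volume (ball (0 : EuclideanSpace ℝ (Fin n)) r)).toReal⁻¹ *
    ∫ x in ball (0 : EuclideanSpace ℝ (Fin n)) r, f (‖y‖ • x)

lemma avgS_meas {f : 𝔼 → ℝ} (hf : Measurable f) (r : ℝ) : Measurable (avgS n f r) := by
  unfold avgS
  refine Measurable.const_mul ?_ _
  have : StronglyMeasurable (fun p : 𝔼 × 𝔼 => f (‖p.1‖ • p.2)) :=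
    Measurable.stronglyMeasurable (by fun_prop)
  exact (this.integral_prod_right (ν := volume.restrict (ball (0 : 𝔼) r))).measurable

lemma swap_ae (hn : 1 ≤ n) (r : ℝ) :
    ∀ᵐ p ∂((volume.restrict (ball (0 : 𝔼) r)).prod (volume.restrict (ball (0 : 𝔼) 1))),
      ‖(swapT p).2‖ = ‖p.2‖ ∧ ‖p.2‖ • (swapT p).1 = ‖p.1‖ • p.2 := by
  have : Nonempty (Fin n) := ⟨⟨0, hn⟩⟩
  have h0 : ∀ s, ∀ᵐ x : 𝔼 ∂(volume.restrict (ball 0 s)), x ≠ 0 :=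
    fun s => ae_restrict_of_ae (by simp [ae_iff])
  filter_upwards [Measure.quasiMeasurePreserving_fst.ae (h0 r),
    Measure.quasiMeasurePreserving_snd.ae (h0 1)] with p h1 h2
  have h1' : ‖p.1‖ ≠ 0 := by simpa using h1
  have h2' : ‖p.2‖ ≠ 0 := by simpa using h2
  constructor
  · simp [swapT, norm_smul, h1']
  · simp only [swapT, smul_smul]
    congr 1
    field_simp

lemma ballAvg_hardy (hn : 1 ≤ n) {f : 𝔼 → ℝ} {r : ℝ}
    (hint : Integrable (fun p : 𝔼 × 𝔼 => f (‖p.2‖ • p.1))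
      ((volume.restrict (ball (0 : 𝔼) r)).prod (volume.restrict (ball (0 : 𝔼) 1)))) :
    Integrable (fun p : 𝔼 × 𝔼 => f (‖p.1‖ • p.2))
      ((volume.restrict (ball (0 : 𝔼) r)).prod (volume.restrict (ball (0 : 𝔼) 1))) ∧
    Integrable (avgS n f r) (volume.restrict (ball (0 : 𝔼) 1)) ∧
    ballAvg n (sphericalHardy n f) r =
      (volume (ball (0 : 𝔼) 1)).toReal⁻¹ * ∫ y in ball (0 : 𝔼) 1, avgS n f r y := by
  have : Nonempty (Fin n) := ⟨⟨0, hn⟩⟩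
  have hMP := mp_swapT_restrict (volume : Measure 𝔼) r 1
  have hae : (fun p : 𝔼 × 𝔼 => f (‖p.2‖ • p.1)) ∘ swapT
      =ᵐ[(volume.restrict (ball (0 : 𝔼) r)).prod (volume.restrict (ball (0 : 𝔼) 1))]
      (fun p : 𝔼 × 𝔼 => f (‖p.1‖ • p.2)) := by
    filter_upwards [swap_ae hn r] with p hp
    simp only [Function.comp]
    rw [hp.1, hp.2]
  have hint2 : Integrable (fun p : 𝔼 × 𝔼 => f (‖p.1‖ • p.2))
      ((volume.restrict (ball (0 : 𝔼) r)).prod (volume.restrict (ball (0 : 𝔼) 1))) :=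
    (hMP.integrable_comp_of_integrable hint).congr hae
  refine ⟨hint2, hint.integral_prod_right.const_mul _, ?_⟩
  have h0 : ∀ᵐ x : 𝔼 ∂(volume.restrict (ball 0 r)), x ≠ 0 := ae_restrict_of_ae (by simp [ae_iff])
  have e1 : ∫ x in ball (0 : 𝔼) r, sphericalHardy n f x =
      ∫ x in ball (0 : 𝔼) r, (volume (ball (0 : 𝔼) 1)).toReal⁻¹ * ∫ y in ball (0 : 𝔼) 1, f (‖x‖ • y) := by
    refine integral_congr_ae ?_
    filter_upwards [h0] with x hx
    exact hardy_eq hn f hx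
  have e2 : ∫ x in ball (0 : 𝔼) r, ∫ y in ball (0 : 𝔼) 1, f (‖x‖ • y) =
      ∫ y in ball (0 : 𝔼) 1, ∫ x in ball (0 : 𝔼) r, f (‖y‖ • x) := by
    rw [← integral_prod _ hint2, ← integral_prod_symm _ hint, ← integral_congr_ae hae]
    conv_rhs => rw [← hMP.map_eq]
    rw [integral_map hMP.aemeasurable (by rw [hMP.map_eq]; exact hint.1)]
    rfl
  unfold ballAvg avgS
  rw [e1, integral_const_mul, e2, integral_const_mul]
  ring

lemma upper (hn : 1 ≤ n) {q lam : ℝ} (hq : 1 < q) (hlam : -1 < lam) {f : 𝔼 → ℝ} (hf : Measurable f)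
    (hN : cmoNorm n q lam f < ⊤) :
    cmoNorm n q lam (sphericalHardy n f) ≤ ENNReal.ofReal (1 / (1 + lam)) * cmoNorm n q lam f := by
  have : Nonempty (Fin n) := ⟨⟨0, hn⟩⟩
  have hq0 : 0 < q := by linarith
  rw [cmo_le_iff hq]
  intro r hr
  have hcmo := (cmo_le_iff (lam := lam) hq f _).1 le_rfl
  set N := cmoNorm n q lam f
  have hint := integrable_prod_aux hn hq hf (lq_fin hq hf hN hr)
  obtain ⟨hint2, hintm, havg⟩ := ballAvg_hardy hn hint
  have hmm := avgS_meas hf r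
  have hMP := mp_swapT_restrict (volume : Measure 𝔼) r 1
  set ν := volume (ball (0 : 𝔼) 1) with hν
  have hν0 : ν ≠ 0 := vol_pos 1 one_pos
  have hνt : ν ≠ ⊤ := vol_fin 1
  set V := volume (ball (0 : 𝔼) r) with hV
  set c := ballAvg n (sphericalHardy n f) r with hc
  set w : 𝔼 → ℝ≥0∞ := fun y => ENNReal.ofReal ‖y‖ ^ (n * lam) with hw
  have hwm : Measurable w := by fun_prop
  have h0 : ∀ s, ∀ᵐ x : 𝔼 ∂(volume.restrict (ball 0 s)), x ≠ 0 :=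
    fun s => ae_restrict_of_ae (by simp [ae_iff])
  set W := ENNReal.ofReal (1 / (1 + lam)) * ν with hW
  have hWw : ∫⁻ y in ball (0 : 𝔼) 1, w y = W := pow_lint hn hlam
  -- pointwise bound
  have step1 : ∀ᵐ x : 𝔼 ∂(volume.restrict (ball 0 r)),
      ENNReal.ofReal |sphericalHardy n f x - c| ^ q ≤ ν⁻¹ ^ q * W ^ (q - 1) *
        ∫⁻ y in ball (0 : 𝔼) 1, w y ^ (1 - q) * ENNReal.ofReal |f (‖x‖ • y) - avgS n f r y| ^ q := by
    filter_upwards [h0 r, hint2.prod_right_ae] with x hx hxi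
    have e1 : sphericalHardy n f x - c = ν.toReal⁻¹ * ∫ y in ball (0 : 𝔼) 1, (f (‖x‖ • y) - avgS n f r y) := by
      rw [integral_sub hxi hintm, havg, hardy_eq hn f hx]
      ring
    have e2 : ENNReal.ofReal |sphericalHardy n f x - c| ≤
        ν⁻¹ * ∫⁻ y in ball (0 : 𝔼) 1, ENNReal.ofReal |f (‖x‖ • y) - avgS n f r y| := by
      rw [e1, abs_mul, ENNReal.ofReal_mul (abs_nonneg _), abs_of_nonneg (by positivity),
        ENNReal.ofReal_inv_of_pos (ENNReal.toReal_pos hν0 hνt), ENNReal.ofReal_toReal hνt]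
      refine mul_le_mul_right ?_ _
      simp only [← Real.enorm_eq_ofReal_abs]
      exact enorm_integral_le_lintegral_enorm _
    have e3 := weighted_holder (volume.restrict (ball (0 : 𝔼) 1)) w
      (fun y => ENNReal.ofReal |f (‖x‖ • y) - avgS n f r y|) (by fun_prop)
      (by fun_prop) (by
        filter_upwards [h0 1] with y hy
        exact (ENNReal.rpow_pos (by simpa using hy) (by simp)).ne') (by
        filter_upwards [h0 1] with y hy
        exact ENNReal.rpow_ne_top_of_ne_zero (by simpa using hy) (by simp)) q hq
    rw [hWw] at e3
    calc _ ≤ _ := ENNReal.rpow_le_rpow e2 hq0.le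
      _ = _ := ENNReal.mul_rpow_of_nonneg _ _ hq0.le
      _ ≤ _ := mul_le_mul_right e3 _
      _ = _ := by rw [mul_assoc]
  -- integrate
  set Ψ : 𝔼 × 𝔼 → ℝ≥0∞ := fun p => w p.2 ^ (1 - q) * ENNReal.ofReal |f (‖p.2‖ • p.1) - avgS n f r p.2| ^ q with hΨ
  have hΨm : Measurable Ψ := by fun_prop
  set Ψ' : 𝔼 × 𝔼 → ℝ≥0∞ := fun p => w p.2 ^ (1 - q) * ENNReal.ofReal |f (‖p.1‖ • p.2) - avgS n f r p.2| ^ q with hΨ'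
  have hΨm' : Measurable Ψ' := by fun_prop
  have step2 : ∫⁻ x in ball (0 : 𝔼) r, ∫⁻ y in ball (0 : 𝔼) 1, Ψ' (x, y) =
      ∫⁻ y in ball (0 : 𝔼) 1, ∫⁻ x in ball (0 : 𝔼) r, Ψ (x, y) := by
    rw [← lintegral_prod _ hΨm'.aemeasurable, ← lintegral_prod_symm _ hΨm.aemeasurable, ← hMP.lintegral_comp hΨm]
    refine lintegral_congr_ae ?_
    filter_upwards [swap_ae hn r] with p hp
    simp only [hΨ, hΨ', hw, avgS]
    rw [hp.1, hp.2]
  have step3 : ∀ᵐ y : 𝔼 ∂(volume.restrict (ball 0 1)), ∫⁻ x in ball (0 : 𝔼) r, Ψ (x, y) ≤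
      N ^ q * V ^ (1 + lam * q) * w y := by
    filter_upwards [h0 1] with y hy
    have hy0 : 0 < ‖y‖ := norm_pos_iff.2 hy
    have hT0 : ENNReal.ofReal ‖y‖ ≠ 0 := by simpa using hy
    have hTt : ENNReal.ofReal ‖y‖ ≠ ⊤ := by simp
    have hav : avgS n f r y = ballAvg n f (‖y‖ * r) := (ballAvg_scale f hy0).symm
    have h1 := hcmo (‖y‖ * r) (by positivity)
    rw [← lint_scale hy0 r (fun x => ENNReal.ofReal |f x - ballAvg n f (‖y‖ * r)| ^ q) (by fun_prop),
      vol_ball_mul hy0, ENNReal.mul_le_iff_le_inv (pow_ne_zero _ hT0) (by simp)] at h1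
    have h2 : ∫⁻ x in ball (0 : 𝔼) r, Ψ (x, y) = w y ^ (1 - q) *
        ∫⁻ x in ball (0 : 𝔼) r, ENNReal.ofReal |f (‖y‖ • x) - ballAvg n f (‖y‖ * r)| ^ q := by
      simp only [hΨ]
      rw [lintegral_const_mul _ (by fun_prop), hav]
    rw [h2]
    refine (mul_le_mul_right h1 _).trans (le_of_eq ?_)
    rw [ENNReal.mul_rpow_of_ne_zero (pow_ne_zero _ hT0) (vol_pos r hr), ← hV]
    simp only [hw]
    set T := ENNReal.ofReal ‖y‖
    rw [← ENNReal.rpow_natCast, ← ENNReal.rpow_mul, ← ENNReal.rpow_mul, ← ENNReal.rpow_neg]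
    have : T ^ (n * lam * (1 - q)) * (T ^ (-(n : ℝ)) * (N ^ q * (T ^ ((n : ℝ) * (1 + lam * q)) * V ^ (1 + lam * q))))
      = N ^ q * V ^ (1 + lam * q) * (T ^ (n * lam * (1 - q)) * T ^ (-(n : ℝ)) * T ^ ((n : ℝ) * (1 + lam * q))) := by ring
    rw [this, ← ENNReal.rpow_add _ _ hT0 hTt, ← ENNReal.rpow_add _ _ hT0 hTt]
    congr 2
    ring
  have hWt : W ≠ ⊤ := ENNReal.mul_ne_top ENNReal.ofReal_ne_top hνt
  have hW0 : W ≠ 0 := by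
    refine mul_ne_zero ?_ hν0
    have : 0 < 1 + lam := by linarith
    simpa using this
  calc ∫⁻ x in ball (0 : 𝔼) r, ENNReal.ofReal |sphericalHardy n f x - c| ^ q
      ≤ ∫⁻ x in ball (0 : 𝔼) r, ν⁻¹ ^ q * W ^ (q - 1) * ∫⁻ y in ball (0 : 𝔼) 1, Ψ' (x, y) :=
        lintegral_mono_ae step1
    _ = ν⁻¹ ^ q * W ^ (q - 1) * ∫⁻ y in ball (0 : 𝔼) 1, ∫⁻ x in ball (0 : 𝔼) r, Ψ (x, y) := by
        rw [lintegral_const_mul _ hΨm'.lintegral_prod_right', step2]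
    _ ≤ ν⁻¹ ^ q * W ^ (q - 1) * ∫⁻ y in ball (0 : 𝔼) 1, N ^ q * V ^ (1 + lam * q) * w y :=
        mul_le_mul_right (lintegral_mono_ae step3) _
    _ = ν⁻¹ ^ q * (W ^ (q - 1) * W ^ (1 : ℝ)) * (N ^ q * V ^ (1 + lam * q)) := by
        rw [lintegral_const_mul _ hwm, hWw, ENNReal.rpow_one]
        ring
    _ = (ν⁻¹ * W) ^ q * (N ^ q * V ^ (1 + lam * q)) := by
        rw [← ENNReal.rpow_add _ _ hW0 hWt, sub_add_cancel, ENNReal.mul_rpow_of_nonneg ν⁻¹ W hq0.le]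
    _ = (ENNReal.ofReal (1 / (1 + lam)) * N) ^ q * V ^ (1 + lam * q) := by
        have : ν⁻¹ * W = ENNReal.ofReal (1 / (1 + lam)) := by
          rw [hW, mul_comm, mul_assoc, ENNReal.mul_inv_cancel hν0 hνt, mul_one]
        rw [this, ENNReal.mul_rpow_of_nonneg _ _ hq0.le, mul_assoc]

end

section
variable {n : ℕ}

local notation "𝔼" => EuclideanSpace ℝ (Fin n)

lemma integrableOn_of_lq {q : ℝ} (hq : 1 < q) {f : 𝔼 → ℝ} (hf : Measurable f) {r : ℝ}
    (h : ∫⁻ x in ball (0 : 𝔼) r, ENNReal.ofReal |f x| ^ q < ⊤) : IntegrableOn f (ball 0 r) := by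
  have hq0 : 0 < q := by linarith
  have e0 : ENNReal.ofReal q ≠ 0 := by simpa using hq0
  have : IsFiniteMeasure (volume.restrict (ball (0 : 𝔼) r)) := ⟨by simpa using (vol_fin r).lt_top⟩
  have h3 : MemLp f (ENNReal.ofReal q) (volume.restrict (ball (0 : 𝔼) r)) := by
    refine ⟨by fun_prop, ?_⟩
    rw [eLpNorm_lt_top_iff_lintegral_rpow_enorm_lt_top e0 (by simp), ENNReal.toReal_ofReal hq0.le]
    simpa only [Real.enorm_eq_ofReal_abs] using h
  exact h3.integrable (by simpa using hq.le)

lemma homog_fin (hn : 1 ≤ n) {q lam : ℝ} (hq : 1 < q) {f : 𝔼 → ℝ} (hf : Measurable f) (β : ℝ → ℝ)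
    (hβ : ∀ t > 0, ∀ x : 𝔼, x ≠ 0 → f (t • x) = t ^ (n * lam) * f x + β t)
    (h : ∫⁻ x in ball (0 : 𝔼) 1, ENNReal.ofReal |f x| ^ q < ⊤) : cmoNorm n q lam f < ⊤ := by
  have : Nonempty (Fin n) := ⟨⟨0, hn⟩⟩
  have hq0 : 0 < q := by linarith
  have e0 : ENNReal.ofReal q ≠ 0 := by simpa using hq0
  have : IsFiniteMeasure (volume.restrict (ball (0 : 𝔼) 1)) := ⟨by simpa using (vol_fin 1).lt_top⟩
  have hi := integrableOn_of_lq hq hf h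
  set ν := volume (ball (0 : 𝔼) 1) with hν
  have hν0 : ν ≠ 0 := vol_pos 1 one_pos
  have hνt : ν ≠ ⊤ := vol_fin 1
  have hνr : ν.toReal ≠ 0 := (ENNReal.toReal_pos hν0 hνt).ne'
  set c := ballAvg n f 1 with hc
  have hI : ∫⁻ x in ball (0 : 𝔼) 1, ENNReal.ofReal |f x - c| ^ q < ⊤ := by
    have h3 : MemLp f (ENNReal.ofReal q) (volume.restrict (ball (0 : 𝔼) 1)) := by
      refine ⟨by fun_prop, ?_⟩
      rw [eLpNorm_lt_top_iff_lintegral_rpow_enorm_lt_top e0 (by simp), ENNReal.toReal_ofReal hq0.le]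
      simpa only [Real.enorm_eq_ofReal_abs] using h
    have h5 := (h3.sub (memLp_const c)).2
    rw [eLpNorm_lt_top_iff_lintegral_rpow_enorm_lt_top e0 (by simp), ENNReal.toReal_ofReal hq0.le] at h5
    simpa [Real.enorm_eq_ofReal_abs] using h5
  set I := ∫⁻ x in ball (0 : 𝔼) 1, ENNReal.ofReal |f x - c| ^ q with hIdef
  have hνe0 : ν ^ (1 + lam * q) ≠ 0 := (ENNReal.rpow_pos (pos_iff_ne_zero.2 hν0) hνt).ne'
  have hνet : ν ^ (1 + lam * q) ≠ ⊤ := ENNReal.rpow_ne_top_of_ne_zero hν0 hνt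
  have hM : ((ν ^ (1 + lam * q))⁻¹ * I) ^ q⁻¹ < ⊤ :=
    ENNReal.rpow_lt_top_of_nonneg (by positivity) (ENNReal.mul_ne_top (by simpa using hνe0) hI.ne)
  refine lt_of_le_of_lt ?_ hM
  rw [cmo_le_iff hq]
  intro r hr
  rw [ENNReal.rpow_inv_rpow hq0.ne']
  have h0 : ∀ᵐ x : 𝔼 ∂(volume.restrict (ball 0 1)), x ≠ 0 := ae_restrict_of_ae (by simp [ae_iff])
  have hav : ballAvg n f r = r ^ (n * lam) * c + β r := by
    have h1 := ballAvg_scale f (r := 1) hr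
    rw [mul_one] at h1
    have h2 : ∫ x in ball (0 : 𝔼) 1, f (r • x) = ∫ x in ball (0 : 𝔼) 1, (r ^ (n * lam) * f x + β r) := by
      refine integral_congr_ae ?_
      filter_upwards [h0] with x hx
      exact hβ r hr x hx
    rw [h1, h2, integral_add (hi.const_mul _) (integrable_const _), integral_const_mul, hc, ballAvg]
    simp only [integral_const, Measure.real, Measure.restrict_apply_univ, smul_eq_mul, ← hν]
    field_simp
  set T := ENNReal.ofReal r with hT
  have hT0 : T ≠ 0 := by simpa [hT] using hr
  have hTt : T ≠ ⊤ := by simp [hT]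
  have h1 := lint_scale hr 1 (fun x => ENNReal.ofReal |f x - ballAvg n f r| ^ q) (by fun_prop)
  have h2 : ∫⁻ x in ball (0 : 𝔼) 1, ENNReal.ofReal |f (r • x) - ballAvg n f r| ^ q = T ^ (n * lam * q) * I := by
    rw [hIdef, ← lintegral_const_mul _ (by fun_prop)]
    refine lintegral_congr_ae ?_
    filter_upwards [h0] with x hx
    rw [hβ r hr x hx, hav]
    have : r ^ (n * lam) * f x + β r - (r ^ (n * lam) * c + β r) = r ^ (n * lam) * (f x - c) := by ring
    rw [this, abs_mul, abs_of_pos (by positivity), ENNReal.ofReal_mul (by positivity),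
      ENNReal.mul_rpow_of_nonneg _ _ hq0.le, ← ENNReal.ofReal_rpow_of_pos hr, ← ENNReal.rpow_mul]
  have h3 := vol_ball_mul (n := n) hr 1
  rw [mul_one] at h1 h3
  rw [← h1, h2, h3, ← hν, ← hT, ENNReal.mul_rpow_of_ne_zero (pow_ne_zero _ hT0) hν0, ← ENNReal.rpow_natCast,
    ← ENNReal.rpow_mul, ← mul_assoc, ← ENNReal.rpow_add _ _ hT0 hTt]
  have e : (n : ℝ) + n * lam * q = n * (1 + lam * q) := by ring
  rw [e]
  have : (ν ^ (1 + lam * q))⁻¹ * I * (T ^ ((n : ℝ) * (1 + lam * q)) * ν ^ (1 + lam * q)) =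
    (ν ^ (1 + lam * q) * (ν ^ (1 + lam * q))⁻¹) * (T ^ ((n : ℝ) * (1 + lam * q)) * I) := by ring
  rw [this, ENNReal.mul_inv_cancel hνe0 hνet, one_mul]

lemma lower_core (hn : 1 ≤ n) {q lam : ℝ} (hq : 1 < q) {f : 𝔼 → ℝ} (hf : Measurable f)
    {a b : ℝ} (ha : 0 < a) (hfi : ∀ r > 0, IntegrableOn f (ball (0 : 𝔼) r))
    (hH : ∀ x, x ≠ 0 → sphericalHardy n f x = a * f x + b)
    (h0N : cmoNorm n q lam f ≠ 0) (hN : cmoNorm n q lam f ≠ ⊤) (C : ℝ≥0∞)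
    (hC : cmoNorm n q lam (sphericalHardy n f) ≤ C * cmoNorm n q lam f) :
    ENNReal.ofReal a ≤ C := by
  have : Nonempty (Fin n) := ⟨⟨0, hn⟩⟩
  have hq0 : 0 < q := by linarith
  have ha0 : ENNReal.ofReal a ≠ 0 := by simpa using ha
  suffices h : cmoNorm n q lam f ≤ (ENNReal.ofReal a)⁻¹ * cmoNorm n q lam (sphericalHardy n f) by
    rw [← ENNReal.mul_le_iff_le_inv ha0 (by simp)] at h
    have h2 := h.trans hC
    rwa [ENNReal.mul_le_mul_iff_left h0N hN] at h2
  have hcm := (cmo_le_iff (lam := lam) hq (sphericalHardy n f) _).1 le_rfl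
  rw [cmo_le_iff hq]
  intro r hr
  have h1 := hcm r hr
  have h0 : ∀ᵐ x : 𝔼 ∂(volume.restrict (ball 0 r)), x ≠ 0 := ae_restrict_of_ae (by simp [ae_iff])
  have hνr : (volume (ball (0 : 𝔼) r)).toReal ≠ 0 := (ENNReal.toReal_pos (vol_pos r hr) (vol_fin r)).ne'
  have : IsFiniteMeasure (volume.restrict (ball (0 : 𝔼) r)) := ⟨by simpa using (vol_fin r).lt_top⟩
  have hav : ballAvg n (sphericalHardy n f) r = a * ballAvg n f r + b := by
    have h2 : ∫ x in ball (0 : 𝔼) r, sphericalHardy n f x = ∫ x in ball (0 : 𝔼) r, (a * f x + b) := by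
      refine integral_congr_ae ?_
      filter_upwards [h0] with x hx
      exact hH x hx
    unfold ballAvg
    rw [h2, integral_add ((hfi r hr).const_mul _) (integrable_const _), integral_const_mul]
    simp only [integral_const, Measure.real, Measure.restrict_apply_univ, smul_eq_mul]
    field_simp
  have h2 : ∫⁻ x in ball (0 : 𝔼) r, ENNReal.ofReal |sphericalHardy n f x - ballAvg n (sphericalHardy n f) r| ^ q
      = ENNReal.ofReal a ^ q * ∫⁻ x in ball (0 : 𝔼) r, ENNReal.ofReal |f x - ballAvg n f r| ^ q := by
    rw [← lintegral_const_mul _ (by fun_prop)]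
    refine lintegral_congr_ae ?_
    filter_upwards [h0] with x hx
    rw [hH x hx, hav]
    have : a * f x + b - (a * ballAvg n f r + b) = a * (f x - ballAvg n f r) := by ring
    rw [this, abs_mul, abs_of_pos ha, ENNReal.ofReal_mul ha.le, ENNReal.mul_rpow_of_nonneg _ _ hq0.le]
  rw [h2, ENNReal.mul_le_iff_le_inv (ENNReal.rpow_pos (pos_iff_ne_zero.2 ha0) (by simp)).ne'
    (ENNReal.rpow_ne_top_of_nonneg hq0.le (by simp))] at h1
  refine h1.trans (le_of_eq ?_)
  rw [ENNReal.mul_rpow_of_nonneg _ _ hq0.le, ENNReal.inv_rpow, mul_assoc]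

lemma cmo_ne_zero (hn : 1 ≤ n) {q lam : ℝ} (hq : 1 < q) {φ : ℝ → ℝ} (hφ : Measurable φ)
    (hinj : InjOn φ (Ioi 0)) : cmoNorm n q lam (fun x : 𝔼 => φ ‖x‖) ≠ 0 := by
  have : Nonempty (Fin n) := ⟨⟨0, hn⟩⟩
  have hq0 : 0 < q := by linarith
  intro hN
  have h1 := (cmo_le_iff (lam := lam) hq _ _).1 hN.le 1 one_pos
  rw [ENNReal.zero_rpow_of_pos hq0, zero_mul, nonpos_iff_eq_zero, lintegral_eq_zero_iff (by fun_prop)] at h1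
  set c := ballAvg n (fun x : 𝔼 => φ ‖x‖) 1
  have h0 : ∀ᵐ x : 𝔼 ∂(volume.restrict (ball 0 1)), x ≠ 0 := ae_restrict_of_ae (by simp [ae_iff])
  have h2 : ∀ᵐ x : 𝔼 ∂(volume.restrict (ball 0 1)), x ≠ 0 ∧ φ ‖x‖ = c := by
    filter_upwards [h0, h1] with x hx hx1
    refine ⟨hx, ?_⟩
    simp only [Pi.zero_apply, ENNReal.rpow_eq_zero_iff_of_pos hq0, ENNReal.ofReal_eq_zero] at hx1
    have := abs_nonpos_iff.1 hx1
    linarith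
  have hne : volume.restrict (ball (0 : 𝔼) 1) ≠ 0 := by
    intro h
    exact vol_pos (n := n) 1 one_pos (by simpa using h)
  have : (ae (volume.restrict (ball (0 : 𝔼) 1))).NeBot := ae_neBot.2 hne
  obtain ⟨x0, hx0, hx0'⟩ := h2.exists
  have h3 : ∀ᵐ x : 𝔼 ∂(volume.restrict (ball 0 1)), x ∉ sphere (0 : 𝔼) ‖x0‖ := by
    refine ae_restrict_of_ae ?_
    rw [← measure_eq_zero_iff_ae_notMem]
    exact Measure.addHaar_sphere _ _ _
  obtain ⟨x, ⟨hx, hx'⟩, hx3⟩ := (h2.and h3).exists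
  apply hx3
  rw [mem_sphere_zero_iff_norm]
  exact hinj (by simpa using hx) (by simpa using hx0) (hx'.trans hx0'.symm)

lemma lower_gen (hn : 1 ≤ n) {q lam : ℝ} (hq : 1 < q) {φ : ℝ → ℝ} (hφ : Measurable φ)
    (hinj : InjOn φ (Ioi 0)) (β : ℝ → ℝ)
    (hβ : ∀ t > 0, ∀ s > 0, φ (t * s) = t ^ (n * lam) * φ s + β t)
    (h : ∫⁻ x in ball (0 : 𝔼) 1, ENNReal.ofReal |φ ‖x‖| ^ q < ⊤)
    {a b : ℝ} (ha : 0 < a)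
    (hH : ∀ x : 𝔼, x ≠ 0 → sphericalHardy n (fun x : 𝔼 => φ ‖x‖) x = a * φ ‖x‖ + b)
    (C : ℝ≥0∞)
    (hC : ∀ f : EuclideanSpace ℝ (Fin n) → ℝ, Measurable f →
        MeasureTheory.LocallyIntegrable f → cmoNorm n q lam f < ⊤ →
        cmoNorm n q lam (sphericalHardy n f) ≤ C * cmoNorm n q lam f) :
    ENNReal.ofReal a ≤ C := by
  have hm : Measurable (fun x : 𝔼 => φ ‖x‖) := by fun_prop
  have hN : cmoNorm n q lam (fun x : 𝔼 => φ ‖x‖) < ⊤ := by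
    refine homog_fin hn hq hm β ?_ h
    intro t ht x hx
    simp only [norm_smul, Real.norm_eq_abs, abs_of_pos ht]
    exact hβ t ht _ (norm_pos_iff.2 hx)
  have hi : ∀ r > 0, IntegrableOn (fun x : 𝔼 => φ ‖x‖) (ball (0 : 𝔼) r) := fun r hr =>
    integrableOn_of_lq hq hm (lq_fin hq hm hN hr)
  refine lower_core hn hq hm ha hi hH (cmo_ne_zero hn hq hφ hinj) hN.ne C (hC _ hm ?_ hN)
  intro x
  refine ⟨ball 0 (‖x‖ + 1), isOpen_ball.mem_nhds (by simp), hi _ (by positivity)⟩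

lemma hardy_homog (hn : 1 ≤ n) {q lam : ℝ} (hq : 1 < q) {φ : ℝ → ℝ} (hφ : Measurable φ) (β : ℝ → ℝ)
    (hβ : ∀ t > 0, ∀ s > 0, φ (t * s) = t ^ (n * lam) * φ s + β t)
    (h : ∫⁻ x in ball (0 : 𝔼) 1, ENNReal.ofReal |φ ‖x‖| ^ q < ⊤) (x : 𝔼) (hx : x ≠ 0) :
    sphericalHardy n (fun x : 𝔼 => φ ‖x‖) x = ‖x‖ ^ (n * lam) * ballAvg n (fun x : 𝔼 => φ ‖x‖) 1 + β ‖x‖ := by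
  have : Nonempty (Fin n) := ⟨⟨0, hn⟩⟩
  have hm : Measurable (fun x : 𝔼 => φ ‖x‖) := by fun_prop
  have hi := integrableOn_of_lq hq hm h
  have : IsFiniteMeasure (volume.restrict (ball (0 : 𝔼) 1)) := ⟨by simpa using (vol_fin 1).lt_top⟩
  have h0 : ∀ᵐ x : 𝔼 ∂(volume.restrict (ball 0 1)), x ≠ 0 := ae_restrict_of_ae (by simp [ae_iff])
  have hνr : (volume (ball (0 : 𝔼) 1)).toReal ≠ 0 := (ENNReal.toReal_pos (vol_pos 1 one_pos) (vol_fin 1)).ne'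
  rw [hardy_eq hn _ hx]
  have h2 : ∫ y in ball (0 : 𝔼) 1, φ ‖‖x‖ • y‖ = ∫ y in ball (0 : 𝔼) 1, (‖x‖ ^ (n * lam) * φ ‖y‖ + β ‖x‖) := by
    refine integral_congr_ae ?_
    filter_upwards [h0] with y hy
    simp only [norm_smul, norm_norm]
    exact hβ _ (norm_pos_iff.2 hx) _ (norm_pos_iff.2 hy)
  rw [h2, integral_add (hi.const_mul _) (integrable_const _), integral_const_mul, ballAvg]
  simp only [integral_const, Measure.real, Measure.restrict_apply_univ, smul_eq_mul]
  field_simp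

end

lemma lower_pow {n : ℕ} (hn : 1 ≤ n) {q lam : ℝ} (hq : 1 < q) (hlam₁ : -(1 / q) < lam) (h0 : lam ≠ 0)
    (C : ℝ≥0∞)
    (hC : ∀ f : EuclideanSpace ℝ (Fin n) → ℝ, Measurable f →
        MeasureTheory.LocallyIntegrable f → cmoNorm n q lam f < ⊤ →
        cmoNorm n q lam (sphericalHardy n f) ≤ C * cmoNorm n q lam f) :
    ENNReal.ofReal (1 / (1 + lam)) ≤ C := by
  have : Nonempty (Fin n) := ⟨⟨0, hn⟩⟩
  have hq0 : 0 < q := by linarith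
  have hn0 : (0 : ℝ) < n := by exact_mod_cast hn
  have hlq : -1 < lam * q := by
    have := mul_lt_mul_of_pos_right hlam₁ hq0
    rwa [neg_mul, one_div_mul_cancel hq0.ne'] at this
  have hl1 : -1 < lam := by
    have : 1 / q < 1 := by rw [div_lt_one hq0]; exact hq
    linarith
  have hβ : ∀ t > (0 : ℝ), ∀ s > (0 : ℝ), (t * s) ^ (n * lam) = t ^ (n * lam) * s ^ (n * lam) + (fun _ => 0 : ℝ → ℝ) t := by
    intro t ht s hs
    simp [Real.mul_rpow ht.le hs.le]
  have hm : Measurable (fun t : ℝ => t ^ (n * lam)) := by fun_prop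
  have hI : ∫⁻ x in ball (0 : EuclideanSpace ℝ (Fin n)) 1, ENNReal.ofReal |‖x‖ ^ (n * lam)| ^ q < ⊤ := by
    have hae : ∀ᵐ x : EuclideanSpace ℝ (Fin n) ∂(volume.restrict (ball 0 1)), x ≠ 0 :=
      ae_restrict_of_ae (by simp [ae_iff])
    have : ∫⁻ x in ball (0 : EuclideanSpace ℝ (Fin n)) 1, ENNReal.ofReal |‖x‖ ^ (n * lam)| ^ q =
        ∫⁻ x in ball (0 : EuclideanSpace ℝ (Fin n)) 1, ENNReal.ofReal ‖x‖ ^ (n * (lam * q)) := by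
      refine lintegral_congr_ae ?_
      filter_upwards [hae] with x hx
      rw [abs_of_nonneg (by positivity), ← ENNReal.ofReal_rpow_of_pos (norm_pos_iff.2 hx), ← ENNReal.rpow_mul, mul_assoc]
    rw [this, pow_lint hn hlq]
    exact ENNReal.mul_lt_top ENNReal.ofReal_lt_top (vol_fin 1).lt_top
  have h1l : 0 < 1 + lam := by linarith
  refine lower_gen hn hq hm ?_ (fun _ => 0) hβ hI (a := 1 / (1 + lam)) (b := 0) (by positivity) ?_ C hC
  · intro s hs t ht hst
    exact (Real.rpow_left_inj (le_of_lt hs) (le_of_lt ht) (mul_ne_zero hn0.ne' h0)).1 hst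
  · intro x hx
    rw [hardy_homog hn hq hm (fun _ => 0) hβ hI x hx, ballAvg, (pow_int_real hn hl1).2]
    have hνr : (volume (ball (0 : EuclideanSpace ℝ (Fin n)) 1)).toReal ≠ 0 :=
      (ENNReal.toReal_pos (vol_pos 1 one_pos) (vol_fin 1)).ne'
    field_simp

lemma lower_log {n : ℕ} (hn : 1 ≤ n) {q : ℝ} (hq : 1 < q) (C : ℝ≥0∞)
    (hC : ∀ f : EuclideanSpace ℝ (Fin n) → ℝ, Measurable f →
        MeasureTheory.LocallyIntegrable f → cmoNorm n q 0 f < ⊤ →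
        cmoNorm n q 0 (sphericalHardy n f) ≤ C * cmoNorm n q 0 f) :
    ENNReal.ofReal 1 ≤ C := by
  have : Nonempty (Fin n) := ⟨⟨0, hn⟩⟩
  have hq0 : 0 < q := by linarith
  have hn0 : (0 : ℝ) < n := by exact_mod_cast hn
  have hβ : ∀ t > (0 : ℝ), ∀ s > (0 : ℝ), Real.log (t * s) = t ^ ((n : ℝ) * 0) * Real.log s + Real.log t := by
    intro t ht s hs
    simp [Real.log_mul ht.ne' hs.ne', add_comm]
  have hI : ∫⁻ x in ball (0 : EuclideanSpace ℝ (Fin n)) 1, ENNReal.ofReal |Real.log ‖x‖| ^ q < ⊤ := by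
    have hae : ∀ᵐ x : EuclideanSpace ℝ (Fin n) ∂(volume.restrict (ball 0 1)), x ≠ 0 :=
      ae_restrict_of_ae (by simp [ae_iff])
    set ε : ℝ := n * (1 / 2) / q with hε
    have hε0 : 0 < ε := by positivity
    have hb : ∫⁻ x in ball (0 : EuclideanSpace ℝ (Fin n)) 1, ENNReal.ofReal |Real.log ‖x‖| ^ q ≤
        ∫⁻ x in ball (0 : EuclideanSpace ℝ (Fin n)) 1,
          ENNReal.ofReal (1 / ε) ^ q * ENNReal.ofReal ‖x‖ ^ (n * (-(1 / 2) : ℝ)) := by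
      refine lintegral_mono_ae ?_
      filter_upwards [hae, ae_restrict_mem measurableSet_ball] with x hx hx1
      have hx0 : 0 < ‖x‖ := norm_pos_iff.2 hx
      have hx1 : ‖x‖ < 1 := by simpa using hx1
      have h1 := Real.abs_log_mul_self_rpow_lt ‖x‖ ε hx0 hx1.le hε0
      have h2 : |Real.log ‖x‖| ≤ 1 / ε * ‖x‖ ^ (-ε) := by
        rw [abs_mul, abs_of_pos (Real.rpow_pos_of_pos hx0 ε)] at h1
        rw [Real.rpow_neg hx0.le, ← div_eq_mul_inv, le_div_iff₀ (Real.rpow_pos_of_pos hx0 ε)]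
        exact h1.le
      refine (ENNReal.rpow_le_rpow (ENNReal.ofReal_le_ofReal h2) hq0.le).trans (le_of_eq ?_)
      rw [ENNReal.ofReal_mul (by positivity), ENNReal.mul_rpow_of_nonneg _ _ hq0.le,
        ← ENNReal.ofReal_rpow_of_pos hx0, ← ENNReal.rpow_mul]
      congr 2
      rw [hε]
      field_simp
    refine hb.trans_lt ?_
    rw [lintegral_const_mul _ (by fun_prop), pow_lint hn (by norm_num)]
    exact ENNReal.mul_lt_top (ENNReal.rpow_lt_top_of_nonneg hq0.le (by simp))
      (ENNReal.mul_lt_top ENNReal.ofReal_lt_top (vol_fin 1).lt_top)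
  refine lower_gen (b := ballAvg n (fun x : EuclideanSpace ℝ (Fin n) => Real.log ‖x‖) 1)
    hn hq Real.measurable_log Real.log_injOn_pos Real.log hβ hI one_pos ?_ C hC
  intro x hx
  rw [hardy_homog hn hq Real.measurable_log Real.log hβ hI x hx]
  simp [add_comm]

/-- For `1 < q < ∞` and `-1/q < λ < 1/n`, the spherical Hardy operator satisfies
`‖𝓗f‖_{CMO^{q,λ}} ≤ (1/(1+λ)) ‖f‖_{CMO^{q,λ}}`, and `1/(1+λ)` is its exact operator norm
on `CMO^{q,λ}(ℝⁿ)`; in particular for `λ = 0` the operator norm on `CMO^q(ℝⁿ)` is `1`. -/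
theorem sphericalHardy_cmo_norm (n : ℕ) (hn : 1 ≤ n) (q lam : ℝ)
    (hq : 1 < q) (hlam₁ : -(1 / q) < lam) (hlam₂ : lam < 1 / n) :
    (∀ f : EuclideanSpace ℝ (Fin n) → ℝ, Measurable f →
      MeasureTheory.LocallyIntegrable f → cmoNorm n q lam f < ⊤ →
      cmoNorm n q lam (sphericalHardy n f)
        ≤ ENNReal.ofReal (1 / (1 + lam)) * cmoNorm n q lam f) ∧
    (∀ C : ℝ≥0∞,
      (∀ f : EuclideanSpace ℝ (Fin n) → ℝ, Measurable f →
        MeasureTheory.LocallyIntegrable f → cmoNorm n q lam f < ⊤ →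
        cmoNorm n q lam (sphericalHardy n f) ≤ C * cmoNorm n q lam f) →
      ENNReal.ofReal (1 / (1 + lam)) ≤ C) := by
  have hq0 : 0 < q := by linarith
  have hl1 : -1 < lam := by
    have : 1 / q < 1 := by rw [div_lt_one hq0]; exact hq
    linarith
  refine ⟨fun f hf _ hN => upper hn hq hl1 hf hN, fun C hC => ?_⟩
  by_cases h0 : lam = 0
  · subst h0
    simpa using lower_log hn hq C hC
  · exact lower_pow hn hq hlam₁ h0 C hC
end

section
/- Let 0 < β < n, 1 < p < ∞, 1 ≤ q < ∞, α₁ < n(p-1), n + α₂ > 0, 0 < β ≤ α₁/(p-1), and (α₂+n)/q = (α₁+n)/p − β. Then the fractional Hardy operator H_β maps L^p(ℝⁿ, |x|^{α₁} dx) to weak L^q(ℝⁿ, |x|^{α₂} dx) with operator norm exactly ν_n^{β/n - 1} (ω_n/(n − α₁/(p-1)))^{1/p'} (ω_n/(n + α₂))^{1/q}. -/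
open MeasureTheory Set ENNReal Metric

/-- The `L^p` norm with respect to the weight `|x|^α`. -/
noncomputable def lpNormW (n : ℕ) (p α : ℝ) (f : EuclideanSpace ℝ (Fin n) → ℝ) : ℝ≥0∞ :=
  (∫⁻ x, ENNReal.ofReal |f x| ^ p ∂(powMeasure n α)) ^ (1 / p)

/-- The weak `L^q(|x|^α)` quasinorm `sup_{λ>0} λ (∫_{|g|>λ} |x|^α dx)^{1/q}`. -/
noncomputable def weakNormW (n : ℕ) (q α : ℝ) (g : EuclideanSpace ℝ (Fin n) → ℝ) : ℝ≥0∞ :=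
  ⨆ (lam : ℝ) (_ : 0 < lam),
    ENNReal.ofReal lam *
      (powMeasure n α {x : EuclideanSpace ℝ (Fin n) | lam < |g x|}) ^ (1 / q)

/-- The fractional Hardy operator `H_β f(x) = |B(0,|x|)|^{β/n - 1} ∫_{|y|≤|x|} f(y) dy`. -/
noncomputable def fracHardy (n : ℕ) (β : ℝ) (f : EuclideanSpace ℝ (Fin n) → ℝ)
    (x : EuclideanSpace ℝ (Fin n)) : ℝ :=
  (volume (ball (0 : EuclideanSpace ℝ (Fin n)) ‖x‖)).toReal ^ (β / n - 1) *
    ∫ y in closedBall (0 : EuclideanSpace ℝ (Fin n)) ‖x‖, f y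


section helpers

variable {n : ℕ}

lemma fh_radial (hn : 1 ≤ n) (s : ℝ) (hs : 0 < n + s) {r : ℝ} (hr : 0 < r) :
    IntegrableOn (fun x : EuclideanSpace ℝ (Fin n) => ‖x‖ ^ s) (ball 0 r) ∧
    ∫ x in ball (0 : EuclideanSpace ℝ (Fin n)) r, ‖x‖ ^ s =
      (n * (volume (ball (0 : EuclideanSpace ℝ (Fin n)) 1)).toReal) / (n + s) * r ^ (n + s) := by
  have : Nonempty (Fin n) := ⟨⟨0, hn⟩⟩
  have hpow : ∀ y ∈ Ioo (0:ℝ) r, y ^ (n - 1) • y ^ s = y ^ ((n:ℝ) - 1 + s) := by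
    intro y hy
    rw [smul_eq_mul, Real.rpow_add hy.1, ← Real.rpow_natCast]
    congr 2
    push_cast [Nat.cast_sub hn]
    ring
  constructor
  · rw [integrableOn_fun_norm_addHaar volume (f := fun t : ℝ => t ^ s)]
    simp only [finrank_euclideanSpace, Fintype.card_fin]
    rw [integrableOn_congr_fun hpow measurableSet_Ioo, intervalIntegral.integrableOn_Ioo_rpow_iff hr]
    linarith
  · have h1 : ∫ x in ball (0 : EuclideanSpace ℝ (Fin n)) r, ‖x‖ ^ s =
        ∫ x : EuclideanSpace ℝ (Fin n), (Iio r).indicator (fun t : ℝ => t ^ s) ‖x‖ := by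
      rw [← integral_indicator measurableSet_ball]
      congr 1
      ext x
      simp [indicator]
    rw [h1, integral_fun_norm_addHaar volume]
    simp only [finrank_euclideanSpace, Fintype.card_fin]
    have h2 : ∫ y in Ioi (0:ℝ), y ^ (n - 1) • (Iio r).indicator (fun t : ℝ => t ^ s) y =
        ∫ y in Ioo (0:ℝ) r, y ^ ((n:ℝ) - 1 + s) := by
      rw [← integral_indicator measurableSet_Ioi, ← integral_indicator measurableSet_Ioo]
      congr 1
      ext y
      by_cases h0 : 0 < y <;> by_cases hyr : y < r
      · have := hpow y ⟨h0, hyr⟩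
        simpa [indicator, h0, hyr] using this
      all_goals simp [indicator, h0, hyr]
    rw [h2, ← integral_Ioc_eq_integral_Ioo, ← intervalIntegral.integral_of_le hr.le,
      integral_rpow (Or.inl (by linarith))]
    have e : (n:ℝ) - 1 + s + 1 = n + s := by ring
    rw [e, Real.zero_rpow hs.ne', Measure.real]
    simp only [nsmul_eq_mul, smul_eq_mul]
    ring

lemma fh_lradial (hn : 1 ≤ n) (s : ℝ) (hs : 0 < n + s) {r : ℝ} (hr : 0 < r) :
    ∫⁻ x in ball (0 : EuclideanSpace ℝ (Fin n)) r, ENNReal.ofReal (‖x‖ ^ s) =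
      ENNReal.ofReal ((n * (volume (ball (0 : EuclideanSpace ℝ (Fin n)) 1)).toReal) / (n + s)
        * r ^ (n + s)) := by
  obtain ⟨h1, h2⟩ := fh_radial hn s hs hr
  rw [← h2, ofReal_integral_eq_lintegral_ofReal h1]
  exact Filter.Eventually.of_forall fun x => by positivity

lemma fh_restrict (hn : 1 ≤ n) (r : ℝ) :
    (volume : Measure (EuclideanSpace ℝ (Fin n))).restrict (closedBall 0 r) =
      volume.restrict (ball 0 r) := by
  have : Nonempty (Fin n) := ⟨⟨0, hn⟩⟩
  refine Measure.restrict_congr_set (Filter.EventuallyEq.symm ?_)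
  refine ae_eq_of_subset_of_measure_ge ball_subset_closedBall
    (Measure.addHaar_closedBall_eq_addHaar_ball _ _ _).le measurableSet_ball.nullMeasurableSet ?_
  exact measure_closedBall_lt_top.ne

lemma fh_powMeasure_ball (hn : 1 ≤ n) (s : ℝ) (hs : 0 < n + s) {r : ℝ} (hr : 0 < r) :
    powMeasure n s (ball 0 r) =
      ENNReal.ofReal ((n * (volume (ball (0 : EuclideanSpace ℝ (Fin n)) 1)).toReal) / (n + s)
        * r ^ (n + s)) := by
  rw [powMeasure, withDensity_apply _ measurableSet_ball, fh_lradial hn s hs hr]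

lemma fh_vol (hn : 1 ≤ n) (β : ℝ) {r : ℝ} (hr : 0 < r) :
    (volume (ball (0 : EuclideanSpace ℝ (Fin n)) r)).toReal ^ (β / n - 1) =
      (volume (ball (0 : EuclideanSpace ℝ (Fin n)) 1)).toReal ^ (β / n - 1) * r ^ (β - n) := by
  have hn' : (n:ℝ) ≠ 0 := by positivity
  rw [Measure.addHaar_ball_of_pos _ _ hr, ENNReal.toReal_mul, finrank_euclideanSpace,
    Fintype.card_fin, ENNReal.toReal_ofReal (by positivity),
    Real.mul_rpow (by positivity) ENNReal.toReal_nonneg, mul_comm, ← Real.rpow_natCast,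
    ← Real.rpow_mul hr.le]
  congr 2
  field_simp

lemma fh_holder (hn : 1 ≤ n) {p α : ℝ} (hp : 1 < p) (hα : α < n * (p - 1))
    (f : EuclideanSpace ℝ (Fin n) → ℝ) (hf : Measurable f) {r : ℝ} (hr : 0 < r) :
    ∫⁻ y in closedBall (0 : EuclideanSpace ℝ (Fin n)) r, ‖f y‖ₑ ≤
      lpNormW n p α f *
      ENNReal.ofReal ((n * (volume (ball (0 : EuclideanSpace ℝ (Fin n)) 1)).toReal) /
        (n - α / (p - 1)) * r ^ (n - α / (p - 1))) ^ (1 - 1 / p) := by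
  have : Nonempty (Fin n) := ⟨⟨0, hn⟩⟩
  have hp1 : 0 < p - 1 := by linarith
  have hp0 : 0 < p := by linarith
  have hs : 0 < (n:ℝ) + (-(α / (p - 1))) := by
    have : α / (p - 1) < n := by rwa [div_lt_iff₀ hp1]
    linarith
  have hpq : p.HolderConjugate (p / (p - 1)) := Real.HolderConjugate.conjExponent hp
  rw [fh_restrict hn]
  have key := ENNReal.lintegral_mul_le_Lp_mul_Lq
    ((volume : Measure (EuclideanSpace ℝ (Fin n))).restrict (ball 0 r)) hpq
    (f := fun y => ENNReal.ofReal |f y| * ENNReal.ofReal (‖y‖ ^ (α / p)))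
    (g := fun y => ENNReal.ofReal (‖y‖ ^ (-(α / p))))
    (by fun_prop) (by fun_prop)
  have hne : ∀ᵐ y ∂((volume : Measure (EuclideanSpace ℝ (Fin n))).restrict (ball 0 r)), y ≠ 0 :=
    ae_restrict_of_ae (Measure.ae_ne volume 0)
  calc _ = _ := ?_
    _ ≤ _ := key
    _ ≤ _ := ?_
  · refine lintegral_congr_ae ?_
    filter_upwards [hne] with y hy
    have hy' : 0 < ‖y‖ := norm_pos_iff.2 hy
    simp only [Pi.mul_apply]
    rw [mul_assoc, ← ENNReal.ofReal_mul (by positivity), ← Real.rpow_add hy', add_neg_cancel,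
      Real.rpow_zero, ENNReal.ofReal_one, mul_one, ← Real.norm_eq_abs, ofReal_norm]
  · have e1 : 1 / (p / (p - 1)) = 1 - 1 / p := by field_simp
    rw [e1]
    refine mul_le_mul' ?_ ?_
    · rw [lpNormW, powMeasure, lintegral_withDensity_eq_lintegral_mul _ (by fun_prop) (by fun_prop)]
      refine ENNReal.rpow_le_rpow ?_ (by positivity)
      refine le_trans (le_of_eq ?_) (setLIntegral_le_lintegral (ball 0 r) _)
      refine lintegral_congr_ae ?_
      filter_upwards [hne] with y hy
      have hy' : 0 < ‖y‖ := norm_pos_iff.2 hy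
      simp only [Pi.mul_apply]
      rw [ENNReal.mul_rpow_of_nonneg _ _ hp0.le, mul_comm,
        ENNReal.ofReal_rpow_of_pos (by positivity), ← Real.rpow_mul hy'.le, div_mul_cancel₀ _ hp0.ne']
    · refine ENNReal.rpow_le_rpow (le_of_eq ?_) ?_
      · have := fh_lradial hn _ hs hr
        rw [← sub_eq_add_neg] at this
        rw [← this]
        refine lintegral_congr_ae ?_
        filter_upwards [hne] with y hy
        have hy' : 0 < ‖y‖ := norm_pos_iff.2 hy
        rw [ENNReal.ofReal_rpow_of_pos (by positivity), ← Real.rpow_mul hy'.le]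
        congr 2
        field_simp
      · rw [← e1]; positivity

lemma fh_pointwise (hn : 1 ≤ n) {β p q α₁ α₂ : ℝ} (hp : 1 < p)
    (hα₁ : α₁ < n * (p - 1)) 
    (hscale : (α₂ + n) / q = (α₁ + n) / p - β)
    (f : EuclideanSpace ℝ (Fin n) → ℝ) (hf : Measurable f) (hfin : lpNormW n p α₁ f < ⊤)
    (x : EuclideanSpace ℝ (Fin n)) (hx : x ≠ 0) :
    |fracHardy n β f x| ≤
      (volume (ball (0 : EuclideanSpace ℝ (Fin n)) 1)).toReal ^ (β / n - 1) *
            ((n * (volume (ball (0 : EuclideanSpace ℝ (Fin n)) 1)).toReal) /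
                (n - α₁ / (p - 1))) ^ (1 - 1 / p) * (lpNormW n p α₁ f).toReal *
        ‖x‖ ^ (-((α₂ + n) / q)) := by
  have hr : 0 < ‖x‖ := norm_pos_iff.2 hx
  have hp1 : 0 < p - 1 := by linarith
  have hp0 : 0 < p := by linarith
  have hs : 0 < (n:ℝ) - α₁ / (p - 1) := by
    have : α₁ / (p - 1) < n := by rwa [div_lt_iff₀ hp1]
    linarith
  have he : 0 ≤ 1 - 1 / p := by
    have : 1 / p ≤ 1 := by rw [div_le_one hp0]; exact hp.le
    linarith
  have h := (enorm_integral_le_lintegral_enorm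
    (μ := volume.restrict (closedBall (0 : EuclideanSpace ℝ (Fin n)) ‖x‖)) f).trans
    (fh_holder hn hp hα₁ f hf hr)
  set A := (n * (volume (ball (0 : EuclideanSpace ℝ (Fin n)) 1)).toReal) /
                (n - α₁ / (p - 1)) with hA
  have hA0 : 0 ≤ A := by positivity
  rw [ENNReal.ofReal_rpow_of_nonneg (by positivity) he, ← ofReal_norm,
    ENNReal.ofReal_le_iff_le_toReal (ENNReal.mul_ne_top hfin.ne ENNReal.ofReal_ne_top),
    ENNReal.toReal_mul, ENNReal.toReal_ofReal (by positivity),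
    Real.mul_rpow hA0 (by positivity), ← Real.rpow_mul hr.le] at h
  rw [fracHardy, abs_mul, abs_of_nonneg (by positivity), fh_vol hn β hr]
  rw [Real.norm_eq_abs] at h
  have e : -((α₂ + n) / q) = (β - n) + (n - α₁ / (p - 1)) * (1 - 1 / p) := by
    rw [hscale]; field_simp; ring
  rw [e, Real.rpow_add hr]
  refine (mul_le_mul_of_nonneg_left h (by positivity)).trans (le_of_eq ?_)
  ring

lemma fh_upper (hn : 1 ≤ n) {β p q α₁ α₂ : ℝ} (hp : 1 < p) (hq : 1 ≤ q)
    (hα₁ : α₁ < n * (p - 1)) (hα₂ : 0 < n + α₂)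
    (hscale : (α₂ + n) / q = (α₁ + n) / p - β)
    (f : EuclideanSpace ℝ (Fin n) → ℝ) (hf : Measurable f) (hfin : lpNormW n p α₁ f < ⊤) :
      weakNormW n q α₂ (fracHardy n β f)
        ≤ ENNReal.ofReal ((volume (ball (0 : EuclideanSpace ℝ (Fin n)) 1)).toReal ^ (β / n - 1) *
            ((n * (volume (ball (0 : EuclideanSpace ℝ (Fin n)) 1)).toReal) /
                (n - α₁ / (p - 1))) ^ (1 - 1 / p) *
            ((n * (volume (ball (0 : EuclideanSpace ℝ (Fin n)) 1)).toReal) /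
                (n + α₂)) ^ (1 / q)) * lpNormW n p α₁ f := by
  have : Nonempty (Fin n) := ⟨⟨0, hn⟩⟩
  have hpt := fh_pointwise (β := β) (q := q) hn hp hα₁ hscale f hf hfin
  have hp1 : 0 < p - 1 := by linarith
  have hs : 0 < (n:ℝ) - α₁ / (p - 1) := by
    have : α₁ / (p - 1) < n := by rwa [div_lt_iff₀ hp1]
    linarith
  set A := (n * (volume (ball (0 : EuclideanSpace ℝ (Fin n)) 1)).toReal) /
                (n - α₁ / (p - 1)) with hA
  set B := (n * (volume (ball (0 : EuclideanSpace ℝ (Fin n)) 1)).toReal) /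
                (n + α₂) with hB
  have hA0 : 0 ≤ A := by positivity
  have hB0 : 0 ≤ B := by positivity
  set V := (volume (ball (0 : EuclideanSpace ℝ (Fin n)) 1)).toReal ^ (β / n - 1) with hV
  have hV0 : 0 ≤ V := by positivity
  set N := lpNormW n p α₁ f with hN
  set K := V * A ^ (1 - 1 / p) * N.toReal with hK
  have hK0 : 0 ≤ K := by positivity
  have hq0 : 0 < q := by linarith
  have hR : ENNReal.ofReal (V * A ^ (1 - 1 / p) * B ^ (1 / q)) * N =
      ENNReal.ofReal (K * B ^ (1 / q)) := by
    conv_lhs => rw [← ENNReal.ofReal_toReal hfin.ne]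
    rw [← ENNReal.ofReal_mul (by positivity)]
    congr 1
    rw [hK]; ring
  rw [hR, weakNormW]
  refine iSup₂_le fun lam hlam => ?_
  have hH0 : fracHardy n β f 0 = 0 := by
    simp [fracHardy, closedBall_zero]
  have hpos : ∀ x, lam < |fracHardy n β f x| → 0 < ‖x‖ := by
    intro x hx
    rw [norm_pos_iff]
    rintro rfl
    rw [hH0] at hx
    simp at hx
    linarith
  rcases hK0.eq_or_lt with hK1 | hK1
  · have : {x : EuclideanSpace ℝ (Fin n) | lam < |fracHardy n β f x|} = ∅ := by
      ext x
      simp only [mem_ofPred_eq, mem_empty_iff_false, iff_false]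
      intro hx
      have := hpt x (norm_pos_iff.1 (hpos x hx))
      rw [← hK1] at this
      linarith
    rw [this, measure_empty, ENNReal.zero_rpow_of_pos (by positivity)]
    simp
  · have hd : 0 < (n:ℝ) + α₂ := hα₂
    set R := (K / lam) ^ (q / (n + α₂)) with hRdef
    have hR0 : 0 < R := by positivity
    have hsub : {x : EuclideanSpace ℝ (Fin n) | lam < |fracHardy n β f x|} ⊆ ball 0 R := by
      intro x hx
      have hx0 := hpos x hx
      have h1 := lt_of_lt_of_le hx (hpt x (norm_pos_iff.1 hx0))
      rw [mem_ball_zero_iff]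
      rw [Real.rpow_neg hx0.le, ← div_eq_mul_inv, lt_div_iff₀ (by positivity), mul_comm,
        ← lt_div_iff₀ hlam] at h1
      have h2 := Real.rpow_lt_rpow (by positivity) h1 (z := q / (n + α₂)) (by positivity)
      rw [← Real.rpow_mul hx0.le] at h2
      have : (α₂ + n) / q * (q / (n + α₂)) = 1 := by rw [add_comm α₂]; field_simp
      rwa [this, Real.rpow_one] at h2
    have hm := measure_mono (μ := powMeasure n α₂) hsub
    rw [fh_powMeasure_ball hn α₂ hα₂ hR0] at hm
    refine (mul_le_mul' le_rfl (ENNReal.rpow_le_rpow hm (by positivity))).trans (le_of_eq ?_)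
    rw [ENNReal.ofReal_rpow_of_nonneg (by positivity) (by positivity),
      ← ENNReal.ofReal_mul hlam.le, Real.mul_rpow hB0 (by positivity), hRdef,
      ← Real.rpow_mul (by positivity), ← Real.rpow_mul (by positivity)]
    have : q / (n + α₂) * ((n + α₂) * (1 / q)) = 1 := by field_simp
    rw [this, Real.rpow_one]
    congr 1
    field_simp

lemma fh_lower (hn : 1 ≤ n) {β p q α₁ α₂ : ℝ} (hp : 1 < p) (hq : 1 ≤ q)
    (hα₁ : α₁ < n * (p - 1)) (hα₂ : 0 < n + α₂) (hβα : β ≤ α₁ / (p - 1)) (C : ℝ≥0∞)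
    (hC : ∀ f : EuclideanSpace ℝ (Fin n) → ℝ, Measurable f → lpNormW n p α₁ f < ⊤ →
        weakNormW n q α₂ (fracHardy n β f) ≤ C * lpNormW n p α₁ f) :
      ENNReal.ofReal ((volume (ball (0 : EuclideanSpace ℝ (Fin n)) 1)).toReal ^ (β / n - 1) *
          ((n * (volume (ball (0 : EuclideanSpace ℝ (Fin n)) 1)).toReal) /
              (n - α₁ / (p - 1))) ^ (1 - 1 / p) *
          ((n * (volume (ball (0 : EuclideanSpace ℝ (Fin n)) 1)).toReal) /
              (n + α₂)) ^ (1 / q)) ≤ C := by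
  have : Nonempty (Fin n) := ⟨⟨0, hn⟩⟩
  have hp1 : 0 < p - 1 := by linarith
  have hp0 : 0 < p := by linarith
  have hq0 : 0 < q := by linarith
  set a := α₁ / (p - 1) with ha
  have hs : 0 < (n:ℝ) - a := by
    have : a < n := by rwa [ha, div_lt_iff₀ hp1]
    linarith
  have hs' : 0 < (n:ℝ) + -a := by linarith
  have hν : 0 < (volume (ball (0 : EuclideanSpace ℝ (Fin n)) 1)).toReal :=
    ENNReal.toReal_pos (measure_ball_pos _ _ one_pos).ne' measure_ball_lt_top.ne
  set A := (n * (volume (ball (0 : EuclideanSpace ℝ (Fin n)) 1)).toReal) /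
                (n - a) with hA
  set B := (n * (volume (ball (0 : EuclideanSpace ℝ (Fin n)) 1)).toReal) /
                (n + α₂) with hB
  have hA0 : 0 < A := by positivity
  have hB0 : 0 < B := by positivity
  set V := (volume (ball (0 : EuclideanSpace ℝ (Fin n)) 1)).toReal ^ (β / n - 1) with hV
  have hV0 : 0 < V := by positivity
  let f : EuclideanSpace ℝ (Fin n) → ℝ := (ball 0 1).indicator fun y => ‖y‖ ^ (-a)
  have hf : Measurable f := Measurable.indicator (by fun_prop) measurableSet_ball
  -- the norm of f
  have hfn : lpNormW n p α₁ f = ENNReal.ofReal (A ^ (1 / p)) := by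
    rw [lpNormW, ← ENNReal.ofReal_rpow_of_pos hA0]
    congr 1
    rw [powMeasure, lintegral_withDensity_eq_lintegral_mul _ (by fun_prop) (by fun_prop)]
    have h1 := fh_lradial hn (-a) hs' one_pos
    rw [Real.one_rpow, mul_one, ← sub_eq_add_neg, ← hA] at h1
    rw [← h1, ← lintegral_indicator measurableSet_ball]
    refine lintegral_congr_ae ?_
    filter_upwards [Measure.ae_ne volume (0 : EuclideanSpace ℝ (Fin n))] with y hy
    have hy' : 0 < ‖y‖ := norm_pos_iff.2 hy
    simp only [Pi.mul_apply]
    by_cases hyb : y ∈ ball (0 : EuclideanSpace ℝ (Fin n)) 1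
    · simp only [f, indicator_of_mem hyb]
      rw [abs_of_nonneg (by positivity), ENNReal.ofReal_rpow_of_pos (by positivity),
        ← ENNReal.ofReal_mul (by positivity), ← Real.rpow_mul hy'.le, ← Real.rpow_add hy']
      congr 2
      rw [ha]; field_simp; ring
    · simp only [f, indicator_of_notMem hyb]
      simp [ENNReal.zero_rpow_of_pos hp0]
  have hH : ∀ x : EuclideanSpace ℝ (Fin n), x ∈ ball 0 1 → x ≠ 0 → V * A ≤ |fracHardy n β f x| := by
    intro x hx1 hx
    have hr : 0 < ‖x‖ := norm_pos_iff.2 hx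
    rw [mem_ball_zero_iff] at hx1
    have h1 : ∫ y in closedBall (0 : EuclideanSpace ℝ (Fin n)) ‖x‖, f y = A * ‖x‖ ^ (n - a) := by
      rw [fh_restrict hn]
      have h2 := (fh_radial hn (-a) hs' hr).2
      rw [← sub_eq_add_neg, ← hA] at h2
      rw [← h2]
      refine setIntegral_congr_fun measurableSet_ball fun y hy => ?_
      exact indicator_of_mem (ball_subset_ball hx1.le hy) _
    rw [fracHardy, h1, fh_vol hn β hr, abs_of_nonneg (by positivity)]
    have h3 : (1:ℝ) ≤ ‖x‖ ^ (β - n) * ‖x‖ ^ (n - a) := by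
      rw [← Real.rpow_add hr]
      exact Real.one_le_rpow_of_pos_of_le_one_of_nonpos hr hx1.le (by linarith)
    calc V * A = V * A * 1 := by ring
      _ ≤ V * A * (‖x‖ ^ (β - n) * ‖x‖ ^ (n - a)) := by gcongr
      _ = _ := by ring
  have hfin : lpNormW n p α₁ f < ⊤ := by rw [hfn]; exact ENNReal.ofReal_lt_top
  have hmain := hC f hf hfin
  rw [hfn] at hmain
  have hμ : ∀ lam : ℝ, lam < V * A →
      ENNReal.ofReal B ≤
        powMeasure n α₂ {x : EuclideanSpace ℝ (Fin n) | lam < |fracHardy n β f x|} := by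
    intro lam hlam
    have h1 := fh_powMeasure_ball hn α₂ hα₂ one_pos
    rw [Real.one_rpow, mul_one, ← hB] at h1
    rw [← h1]
    refine measure_mono_ae ?_
    have hac : powMeasure n α₂ ≪ volume := withDensity_absolutelyContinuous _ _
    filter_upwards [hac.ae_le (Measure.ae_ne volume (0 : EuclideanSpace ℝ (Fin n)))] with x hx hxb
    exact lt_of_lt_of_le hlam (hH x hxb hx)
  have hweak : ∀ lam : ℝ, 0 < lam → lam < V * A →
      ENNReal.ofReal (lam * B ^ (1 / q)) ≤ C * ENNReal.ofReal (A ^ (1 / p)) := by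
    intro lam h0 h1
    refine le_trans ?_ hmain
    rw [weakNormW]
    refine le_trans ?_ (le_iSup₂ (f := fun (lam : ℝ) (_ : 0 < lam) => ENNReal.ofReal lam *
      (powMeasure n α₂ {x : EuclideanSpace ℝ (Fin n) | lam < |fracHardy n β f x|}) ^ (1 / q)) lam h0)
    rw [ENNReal.ofReal_mul h0.le, ← ENNReal.ofReal_rpow_of_pos hB0]
    exact mul_le_mul' le_rfl (ENNReal.rpow_le_rpow (hμ lam h1) (by positivity))
  rcases eq_or_ne C ⊤ with rfl | hCt
  · exact le_top
  lift C to NNReal using hCt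
  have hfinal : V * A ≤ C * A ^ (1 / p) / B ^ (1 / q) := by
    refine le_of_forall_lt fun c hc => ?_
    obtain ⟨d, hd1, hd2⟩ := exists_between (max_lt hc (show (0:ℝ) < V * A by positivity))
    have h0 : 0 < d := lt_of_le_of_lt (le_max_right _ _) hd1
    have h := hweak d h0 hd2
    rw [← ENNReal.ofReal_coe_nnreal, ← ENNReal.ofReal_mul (by positivity),
      ENNReal.ofReal_le_ofReal_iff (by positivity)] at h
    refine lt_of_lt_of_le (lt_of_le_of_lt (le_max_left _ _) hd1) ?_
    rwa [le_div_iff₀ (by positivity)]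
  rw [← ENNReal.ofReal_coe_nnreal]
  refine ENNReal.ofReal_le_ofReal ?_
  rw [le_div_iff₀ (by positivity)] at hfinal
  rw [Real.rpow_sub hA0, Real.rpow_one]
  have hAp : 0 < A ^ (1 / p) := by positivity
  rw [show V * (A / A ^ (1 / p)) * B ^ (1 / q) = V * A * B ^ (1 / q) / A ^ (1 / p) by ring,
    div_le_iff₀ hAp]
  exact hfinal

end helpers

/-- Sharp weak bound for the fractional Hardy operator between power-weighted spaces:
its norm from `L^p(|x|^{α₁})` to `L^{q,∞}(|x|^{α₂})` is exactly
`ν_n^{β/n-1} (ω_n/(n-α₁/(p-1)))^{1/p'} (ω_n/(n+α₂))^{1/q}`. -/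
theorem fracHardy_weighted_weak_norm (n : ℕ) (hn : 1 ≤ n) (β p q α₁ α₂ : ℝ)
    (hβ₀ : 0 < β) (hβn : β < n) (hp : 1 < p) (hq : 1 ≤ q)
    (hα₁ : α₁ < n * (p - 1)) (hα₂ : 0 < n + α₂) (hβα : β ≤ α₁ / (p - 1))
    (hscale : (α₂ + n) / q = (α₁ + n) / p - β) :
    (∀ f : EuclideanSpace ℝ (Fin n) → ℝ, Measurable f → lpNormW n p α₁ f < ⊤ →
      weakNormW n q α₂ (fracHardy n β f)
        ≤ ENNReal.ofReal ((volume (ball (0 : EuclideanSpace ℝ (Fin n)) 1)).toReal ^ (β / n - 1) *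
            ((n * (volume (ball (0 : EuclideanSpace ℝ (Fin n)) 1)).toReal) /
                (n - α₁ / (p - 1))) ^ (1 - 1 / p) *
            ((n * (volume (ball (0 : EuclideanSpace ℝ (Fin n)) 1)).toReal) /
                (n + α₂)) ^ (1 / q)) * lpNormW n p α₁ f) ∧
    (∀ C : ℝ≥0∞,
      (∀ f : EuclideanSpace ℝ (Fin n) → ℝ, Measurable f → lpNormW n p α₁ f < ⊤ →
        weakNormW n q α₂ (fracHardy n β f) ≤ C * lpNormW n p α₁ f) →
      ENNReal.ofReal ((volume (ball (0 : EuclideanSpace ℝ (Fin n)) 1)).toReal ^ (β / n - 1) *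
          ((n * (volume (ball (0 : EuclideanSpace ℝ (Fin n)) 1)).toReal) /
              (n - α₁ / (p - 1))) ^ (1 - 1 / p) *
          ((n * (volume (ball (0 : EuclideanSpace ℝ (Fin n)) 1)).toReal) /
              (n + α₂)) ^ (1 / q)) ≤ C) := by
  exact ⟨fun f hf hfin => fh_upper hn hp hq hα₁ hα₂ hscale f hf hfin,
    fun C hC => fh_lower hn hp hq hα₁ hα₂ hβα C hC⟩
end
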